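/- arXiv:2301.05003 — 8 statements merged into one kernel-verified Lean document; each statement's English description precedes it below -/
import Mathlib

section
/- Let X be an infinite-dimensional reflexive real Banach space. Then there exist a reflexive real Banach space Y and bounded linear operators T, R : X → Y such that R has rank at most one, ‖T + R‖ > ‖T‖, and T + R does not attain its norm. In particular, the pair (X, Y) fails the compact perturbation property. -/
open Filter Topology

/-- A bundled real Banach space. -/
structure BanachSpace where
  carrier : Type
  [grp : NormedAddCommGroup carrier]
  [mod : NormedSpace ℝ carrier]
  [complete : CompleteSpace carrier]

attribute [instance] BanachSpace.grp BanachSpace.mod BanachSpace.complete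

/-- A bounded linear operator attains its norm if `‖T x‖ = ‖T‖` for some `x` in the
closed unit ball. -/
def NormAttains {X Y : Type*} [NormedAddCommGroup X] [NormedSpace ℝ X]
    [NormedAddCommGroup Y] [NormedSpace ℝ Y] (T : X →L[ℝ] Y) : Prop :=
  ∃ x : X, ‖x‖ ≤ 1 ∧ ‖T x‖ = ‖T‖

/-- The pair `(X, Y)` has the compact perturbation property. -/
def CPP (X Y : Type*) [NormedAddCommGroup X] [NormedSpace ℝ X]
    [NormedAddCommGroup Y] [NormedSpace ℝ Y] : Prop :=
  ∀ T K : X →L[ℝ] Y, IsCompactOperator ⇑K → ‖T‖ < ‖T + K‖ → NormAttains (T + K)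

/-- A normed space is reflexive if the canonical embedding into the bidual is surjective. -/
def IsReflexiveSpace (X : Type*) [NormedAddCommGroup X] [NormedSpace ℝ X] : Prop :=
  Function.Surjective (NormedSpace.inclusionInDoubleDual ℝ X)

section ReflexiveDual

variable {X : Type*} [NormedAddCommGroup X] [NormedSpace ℝ X]

/-- In the dual of a reflexive space, norm-closed convex sets are weak-star closed. -/
theorem IsReflexiveSpace.isClosed_preimage_toStrongDual (hX : IsReflexiveSpace X)
    {s : Set (StrongDual ℝ X)} (hs : Convex ℝ s) (hc : IsClosed s) :
    IsClosed (WeakDual.toStrongDual ⁻¹' s : Set (WeakDual ℝ X)) := by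
  rw [← isOpen_compl_iff, isOpen_iff_mem_nhds]
  intro f hf
  obtain ⟨F, c, hFs, hFf⟩ := geometric_hahn_banach_closed_point hs hc hf
  obtain ⟨x, rfl⟩ := hX F
  have ho : IsOpen {g : WeakDual ℝ X | c < g x} :=
    isOpen_lt continuous_const (WeakDual.eval_continuous x)
  filter_upwards [ho.mem_nhds hFf] with g hg hgs
  exact lt_asymm hg (hFs _ hgs)

/-- Functionals on a reflexive space attain their norm. -/
theorem IsReflexiveSpace.exists_apply_eq_norm (hX : IsReflexiveSpace X) (f : StrongDual ℝ X) :
    ∃ x : X, ‖x‖ ≤ 1 ∧ f x = ‖f‖ := by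
  obtain ⟨F, hF, hFf⟩ := exists_dual_vector'' ℝ f
  obtain ⟨x, rfl⟩ := hX F
  refine ⟨x, ?_, hFf⟩
  rwa [← (NormedSpace.inclusionInDoubleDualLi ℝ (E := X)).norm_map x]

theorem not_finiteDimensional_strongDual (h : ¬ FiniteDimensional ℝ X) :
    ¬ FiniteDimensional ℝ (StrongDual ℝ X) := by
  intro _
  exact h (FiniteDimensional.of_injective
    (NormedSpace.inclusionInDoubleDual ℝ X : X →ₗ[ℝ] StrongDual ℝ (StrongDual ℝ X))
    (NormedSpace.inclusionInDoubleDualLi ℝ (E := X)).injective)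

/-- An infinite-dimensional normed space has an infinite-dimensional closed separable subspace. -/
theorem exists_isSeparable_isClosed_submodule (h : ¬ FiniteDimensional ℝ X) :
    ∃ W : Submodule ℝ X, TopologicalSpace.IsSeparable (W : Set X) ∧ IsClosed (W : Set X) ∧
      ¬ FiniteDimensional ℝ W := by
  let b := Module.Basis.ofVectorSpace ℝ X
  have hinf : Infinite (Module.Basis.ofVectorSpaceIndex ℝ X) := by
    by_contra hfin
    rw [not_infinite_iff_finite] at hfin
    exact h (Module.Finite.of_basis b)
  let e : ℕ → X := fun n => b (Infinite.natEmbedding _ n)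
  have he : LinearIndependent ℝ e :=
    b.linearIndependent.comp _ (Infinite.natEmbedding _).injective
  refine ⟨(Submodule.span ℝ (Set.range e)).topologicalClosure, ?_,
    Submodule.isClosed_topologicalClosure _, fun hW => ?_⟩
  · rw [Submodule.topologicalClosure_coe]
    exact (Set.countable_range e).isSeparable.span.closure
  · have hmem (n : ℕ) : e n ∈ (Submodule.span ℝ (Set.range e)).topologicalClosure :=
      Submodule.le_topologicalClosure _ (Submodule.subset_span ⟨n, rfl⟩)
    have hli : LinearIndependent ℝ (fun n =>
        (⟨e n, hmem n⟩ : (Submodule.span ℝ (Set.range e)).topologicalClosure)) :=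
      LinearIndependent.of_comp (Submodule.subtype _) he
    exact not_finite_iff_infinite.2 (inferInstance : Infinite ℕ) hli.finite

/-- A separable subspace of the dual of a reflexive space is separated by countably many points. -/
theorem IsReflexiveSpace.exists_seq_separating (hX : IsReflexiveSpace X)
    {W : Submodule ℝ (StrongDual ℝ X)} (hW : TopologicalSpace.IsSeparable (W : Set (StrongDual ℝ X))) :
    ∃ x : ℕ → X, ∀ f ∈ W, (∀ i, f (x i) = 0) → f = 0 := by
  obtain ⟨c, hc, hWc⟩ := hW
  obtain ⟨d, hd⟩ := hc.exists_eq_range (by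
    rw [← closure_nonempty_iff]; exact ⟨0, hWc W.zero_mem⟩)
  choose x hx hdx using fun i => hX.exists_apply_eq_norm (d i)
  refine ⟨x, fun f hf h0 => ?_⟩
  by_contra hne
  have hpos : 0 < ‖f‖ := norm_pos_iff.2 hne
  obtain ⟨g, hg, hfg⟩ := Metric.mem_closure_iff.1 (hWc hf) (‖f‖ / 2) (by positivity)
  rw [hd] at hg
  obtain ⟨i, rfl⟩ := hg
  rw [dist_eq_norm] at hfg
  have h1 : ‖d i‖ ≤ ‖f - d i‖ := by
    have h2 := (f - d i).le_opNorm_of_le (hx i)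
    rw [sub_apply, h0 i, hdx i] at h2
    simpa using h2
  have h3 := norm_le_norm_add_norm_sub' f (d i)
  linarith

/-- The part of the closed dual unit ball in a closed subspace, with the weak-star topology. -/
def weakStarBall (W : Submodule ℝ (StrongDual ℝ X)) : Set (WeakDual ℝ X) :=
  WeakDual.toStrongDual ⁻¹' ((W : Set (StrongDual ℝ X)) ∩ Metric.closedBall 0 1)

theorem IsReflexiveSpace.isCompact_weakStarBall (hX : IsReflexiveSpace X)
    {W : Submodule ℝ (StrongDual ℝ X)} (hW : IsClosed (W : Set (StrongDual ℝ X))) :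
    IsCompact (weakStarBall W) :=
  (WeakDual.isCompact_closedBall 0 1).of_isClosed_subset
    (hX.isClosed_preimage_toStrongDual (W.convex.inter (convex_closedBall 0 1))
      (hW.inter Metric.isClosed_closedBall))
    (Set.preimage_mono Set.inter_subset_right)

/-- An infinite-dimensional closed separable subspace of the dual of a reflexive space contains
a weak-star null sequence of unit vectors. -/
theorem IsReflexiveSpace.exists_weakStar_null_seq (hX : IsReflexiveSpace X)
    {W : Submodule ℝ (StrongDual ℝ X)} (hWs : TopologicalSpace.IsSeparable (W : Set (StrongDual ℝ X)))
    (hWc : IsClosed (W : Set (StrongDual ℝ X))) (hW : ¬ FiniteDimensional ℝ W) :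
    ∃ ψ : ℕ → StrongDual ℝ X, (∀ n, ψ n ∈ W) ∧ (∀ n, ‖ψ n‖ = 1) ∧
      Tendsto (fun n => StrongDual.toWeakDual (ψ n)) atTop (𝓝 0) := by
  obtain ⟨x, hx⟩ := hX.exists_seq_separating hWs
  have hex (n : ℕ) : ∃ f : StrongDual ℝ X, f ∈ W ∧ ‖f‖ = 1 ∧ ∀ i < n, f (x i) = 0 := by
    let L : W →ₗ[ℝ] (Fin n → ℝ) :=
      LinearMap.pi fun i =>
        (NormedSpace.inclusionInDoubleDual ℝ X (x i) : StrongDual ℝ X →ₗ[ℝ] ℝ).comp W.subtype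
    have hL : ¬ Function.Injective L := fun h => hW (FiniteDimensional.of_injective L h)
    rw [injective_iff_map_eq_zero] at hL
    push Not at hL
    obtain ⟨f, hf, hf0⟩ := hL
    have hn : ‖(f : StrongDual ℝ X)‖ ≠ 0 := by simpa using hf0
    refine ⟨‖(f : StrongDual ℝ X)‖⁻¹ • (f : StrongDual ℝ X), W.smul_mem _ f.2, ?_, fun i hi => ?_⟩
    · rw [norm_smul, norm_inv, norm_norm, inv_mul_cancel₀ hn]
    · have h0 : (f : StrongDual ℝ X) (x i) = 0 := congrFun hf ⟨i, hi⟩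
      simp [h0]
  choose ψ hψW hψ1 hψ0 using hex
  refine ⟨ψ, hψW, hψ1, (hX.isCompact_weakStarBall hWc).tendsto_nhds_of_unique_mapClusterPt
    (Eventually.of_forall fun n => ⟨hψW n, by simpa using (hψ1 n).le⟩) fun f hf hcl => ?_⟩
  refine hx (WeakDual.toStrongDual f) hf.1 fun i => ?_
  have h1 : MapClusterPt (f (x i)) atTop (fun n => ψ n (x i)) :=
    hcl.continuousAt_comp (WeakDual.eval_continuous (x i)).continuousAt
  have h2 : Tendsto (fun n => ψ n (x i)) atTop (𝓝 0) :=
    tendsto_const_nhds.congr' <| (eventually_gt_atTop i).mono fun n hn => (hψ0 n i hn).symm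
  exact eq_of_nhds_neBot (h1.clusterPt.mono h2)

/-- Some nonempty relatively weak-star open subset of the ball of a closed separable subspace has
small diameter. -/
theorem IsReflexiveSpace.exists_isOpen_small (hX : IsReflexiveSpace X)
    {W : Submodule ℝ (StrongDual ℝ X)} (hWs : TopologicalSpace.IsSeparable (W : Set (StrongDual ℝ X)))
    (hWc : IsClosed (W : Set (StrongDual ℝ X))) {ε : ℝ} (hε : 0 < ε) :
    ∃ (U : Set (WeakDual ℝ X)) (d : StrongDual ℝ X), IsOpen U ∧
      (∃ f ∈ W, ‖f‖ ≤ 1 ∧ StrongDual.toWeakDual f ∈ U) ∧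
      ∀ f ∈ W, ‖f‖ ≤ 1 → StrongDual.toWeakDual f ∈ U → ‖f - d‖ ≤ ε := by
  obtain ⟨c, hc, hWc'⟩ := hWs
  obtain ⟨d, hd⟩ := hc.exists_eq_range (by
    rw [← closure_nonempty_iff]; exact ⟨0, hWc' W.zero_mem⟩)
  have : CompactSpace (weakStarBall W) :=
    isCompact_iff_compactSpace.1 (hX.isCompact_weakStarBall hWc)
  have : Nonempty (weakStarBall W) := ⟨⟨0, W.zero_mem, Metric.mem_closedBall_self zero_le_one⟩⟩
  let C (i : ℕ) : Set (weakStarBall W) :=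
    Subtype.val ⁻¹' (WeakDual.toStrongDual ⁻¹' Metric.closedBall (d i) ε)
  have hC (i : ℕ) : IsClosed (C i) :=
    (WeakDual.isClosed_closedBall (d i) ε).preimage continuous_subtype_val
  have hU : ⋃ i, C i = Set.univ := by
    refine Set.eq_univ_of_forall fun f => ?_
    obtain ⟨g, hg, hfg⟩ := Metric.mem_closure_iff.1 (hWc' f.2.1) ε hε
    rw [hd] at hg
    obtain ⟨i, rfl⟩ := hg
    exact Set.mem_iUnion_of_mem i (Metric.mem_closedBall.2 hfg.le)
  obtain ⟨i, f, hf⟩ := nonempty_interior_of_iUnion_of_closed hC hU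
  obtain ⟨V, hVC, hVo, hfV⟩ := mem_interior.1 hf
  obtain ⟨U, hUo, rfl⟩ := isOpen_induced_iff.1 hVo
  refine ⟨U, d i, hUo, ⟨WeakDual.toStrongDual f, f.2.1, mem_closedBall_zero_iff.1 f.2.2, hfV⟩,
    fun g hgW hg1 hgU => ?_⟩
  have hg : StrongDual.toWeakDual g ∈ weakStarBall W := ⟨hgW, mem_closedBall_zero_iff.2 hg1⟩
  have hgC : (⟨_, hg⟩ : weakStarBall W) ∈ C i := hVC hgU
  exact mem_closedBall_iff_norm.1 hgC

/-- In the dual of an infinite-dimensional reflexive space there are a functional `u` with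
`‖u‖ < 1` and a weak-star null sequence `ψ` of unit vectors with `‖u + ψ n‖` bounded away from `1`
from above. -/
theorem IsReflexiveSpace.exists_norm_add_weakStar_null (hX : IsReflexiveSpace X)
    (hinf : ¬ FiniteDimensional ℝ X) :
    ∃ (u : StrongDual ℝ X) (ψ : ℕ → StrongDual ℝ X) (δ : ℝ), 0 < δ ∧ ‖u‖ < 1 ∧
      (∀ n, ‖ψ n‖ = 1) ∧ (∀ x, Tendsto (fun n => ψ n x) atTop (𝓝 0)) ∧
      ∀ n, 1 + δ ≤ ‖u + ψ n‖ := by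
  obtain ⟨W, hWs, hWc, hW⟩ :=
    exists_isSeparable_isClosed_submodule (not_finiteDimensional_strongDual hinf)
  obtain ⟨ψ, hψW, hψ1, hψ0⟩ := hX.exists_weakStar_null_seq hWs hWc hW
  have key : ∃ (u : StrongDual ℝ X) (δ : ℝ), 0 < δ ∧ ‖u‖ < 1 ∧
      ∃ᶠ n in atTop, 1 + δ ≤ ‖u + ψ n‖ := by
    by_contra! hcon
    obtain ⟨U, d, hUo, ⟨f, hfW, hf1, hfU⟩, hd⟩ :=
      hX.exists_isOpen_small hWs hWc (ε := 1 / 8) (by norm_num)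
    have hcont : Tendsto (fun s : ℝ => ((1 - s) * (1 - s)) • StrongDual.toWeakDual f) (𝓝 0)
        (𝓝 (StrongDual.toWeakDual f)) := by
      have h1 : Continuous fun s : ℝ => ((1 - s) * (1 - s)) • StrongDual.toWeakDual f := by
        fun_prop
      simpa using h1.tendsto 0
    obtain ⟨r, hr, hrU⟩ := Metric.eventually_nhds_iff.1 (hcont.eventually_mem (hUo.mem_nhds hfU))
    obtain ⟨s, hs0, hs⟩ : ∃ s : ℝ, 0 < s ∧ s < min r (1 / 2) := exists_between (by positivity)
    obtain ⟨hsr, hs2⟩ := lt_min_iff.1 hs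
    have hsU := hrU (show dist s 0 < r by simpa [abs_of_pos hs0] using hsr)
    have hu1 : ‖(1 - s) • f‖ ≤ 1 - s := by
      rw [norm_smul, Real.norm_of_nonneg (by linarith)]
      nlinarith
    have hlim : Tendsto (fun n => ((1 - s) * (1 - s)) • StrongDual.toWeakDual f +
        (1 - s) • StrongDual.toWeakDual (ψ n)) atTop
        (𝓝 (((1 - s) * (1 - s)) • StrongDual.toWeakDual f)) := by
      simpa using (hψ0.const_smul (1 - s)).const_add
        (((1 - s) * (1 - s)) • StrongDual.toWeakDual f)
    obtain ⟨n, hn, hnU⟩ := ((hcon ((1 - s) • f) s hs0 (by linarith)).and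
      (hlim.eventually_mem (hUo.mem_nhds hsU))).exists
    have hA : ‖((1 - s) * (1 - s)) • f - d‖ ≤ 1 / 8 := by
      refine hd _ (W.smul_mem _ hfW) ?_ (by simpa only [map_smul] using hsU)
      rw [mul_smul, norm_smul, Real.norm_of_nonneg (by linarith)]
      nlinarith
    have hB : ‖((1 - s) * (1 - s)) • f + (1 - s) • ψ n - d‖ ≤ 1 / 8 := by
      refine hd _ (W.add_mem (W.smul_mem _ hfW) (W.smul_mem _ (hψW n))) ?_
        (by simpa only [map_add, map_smul] using hnU)
      rw [mul_smul, ← smul_add, norm_smul, Real.norm_of_nonneg (by linarith)]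
      nlinarith
    have hC : ‖(1 - s) • ψ n‖ = 1 - s := by
      rw [norm_smul, Real.norm_of_nonneg (by linarith), hψ1, mul_one]
    have hD : (1 - s) • ψ n =
        (((1 - s) * (1 - s)) • f + (1 - s) • ψ n - d) - (((1 - s) * (1 - s)) • f - d) := by abel
    have hE := norm_sub_le (((1 - s) * (1 - s)) • f + (1 - s) • ψ n - d)
      (((1 - s) * (1 - s)) • f - d)
    rw [← hD, hC] at hE
    linarith
  obtain ⟨u, δ, hδ, hu, hfr⟩ := key
  obtain ⟨σ, hσ, hσδ⟩ := extraction_of_frequently_atTop hfr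
  refine ⟨u, ψ ∘ σ, δ, hδ, hu, fun n => hψ1 _, fun x => ?_, hσδ⟩
  exact (((WeakDual.eval_continuous x).tendsto 0).comp hψ0).comp hσ.tendsto_atTop

end ReflexiveDual

/-- A normed space isomorphic to `X × ℝ` with `X` reflexive is reflexive. -/
theorem IsReflexiveSpace.of_prod_real_equiv {X Y : Type*} [NormedAddCommGroup X] [NormedSpace ℝ X]
    [NormedAddCommGroup Y] [NormedSpace ℝ Y] (hX : IsReflexiveSpace X) (e : (X × ℝ) ≃L[ℝ] Y) :
    IsReflexiveSpace Y := by
  intro F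
  let P : Y →L[ℝ] X := (ContinuousLinearMap.fst ℝ X ℝ).comp (e.symm : Y →L[ℝ] X × ℝ)
  let p : StrongDual ℝ Y := (ContinuousLinearMap.snd ℝ X ℝ).comp (e.symm : Y →L[ℝ] X × ℝ)
  let F₁ : StrongDual ℝ (StrongDual ℝ X) := F.comp ((ContinuousLinearMap.compL ℝ Y X ℝ).flip P)
  obtain ⟨x, hx⟩ := hX F₁
  refine ⟨e (x, F p), ?_⟩
  ext g
  let g₁ : StrongDual ℝ X :=
    g.comp ((e : X × ℝ →L[ℝ] Y).comp (ContinuousLinearMap.inl ℝ X ℝ))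
  have hsplit (z : X) (t : ℝ) : g (e (z, t)) = g₁ z + t * g (e (0, 1)) := by
    have h : (z, t) = (z, (0 : ℝ)) + t • ((0 : X), (1 : ℝ)) := by simp
    rw [h, map_add, map_add, map_smul, map_smul, smul_eq_mul]
    rfl
  have hg : g = g₁.comp P + g (e (0, 1)) • p := by
    ext y
    obtain ⟨⟨z, t⟩, rfl⟩ := e.surjective y
    rw [hsplit]
    simp [P, p, mul_comm]
  have hF : F (g₁.comp P) = g₁ x := (DFunLike.congr_fun hx g₁).symm
  rw [NormedSpace.dual_def, hsplit]
  conv_rhs => rw [hg]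
  rw [map_add, map_smul, hF, smul_eq_mul, mul_comm]

/-- A bounded sequence of functionals and a positive multiple of the norm define an equivalent
norm. -/
theorem exists_renorming {E : Type} [NormedAddCommGroup E] [NormedSpace ℝ E] [CompleteSpace E]
    (g : ℕ → StrongDual ℝ E) {C : ℝ} (hg : ∀ n, ‖g n‖ ≤ C) {ε : ℝ} (hε : 0 < ε) :
    ∃ (Y : BanachSpace) (e : E ≃L[ℝ] Y.carrier), ∀ (p : E) (c : ℝ), 0 ≤ c →
      (‖e p‖ ≤ c ↔ (∀ n, |g n p| ≤ c) ∧ ε * ‖p‖ ≤ c) := by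
  have hb (p : E) (n : ℕ) : ‖g n p‖ ≤ C * ‖p‖ := (g n).le_of_opNorm_le (hg n) p
  let A₀ : E →ₗ[ℝ] BoundedContinuousFunction ℕ ℝ :=
    { toFun := fun p => .ofNormedAddCommGroupDiscrete (fun n => g n p) (C * ‖p‖) (hb p)
      map_add' := fun p q => by ext n; simp
      map_smul' := fun c p => by ext n; simp }
  let A : E →L[ℝ] BoundedContinuousFunction ℕ ℝ := A₀.mkContinuous C fun p =>
    (BoundedContinuousFunction.norm_le ((norm_nonneg _).trans (hb p 0))).2 (hb p)
  let J : E →L[ℝ] BoundedContinuousFunction ℕ ℝ × E := A.prod (ε • ContinuousLinearMap.id ℝ E)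
  have hJ : AntilipschitzWith (Real.toNNReal ε⁻¹) J := by
    refine ContinuousLinearMap.antilipschitz_of_bound J fun p => ?_
    have h : ‖ε • p‖ ≤ ‖J p‖ := norm_snd_le (J p)
    rw [norm_smul, Real.norm_of_nonneg hε.le] at h
    rwa [Real.coe_toNNReal _ (inv_nonneg.2 hε.le), inv_mul_eq_div, le_div_iff₀' hε]
  have hclosed : IsClosed (Set.range J) := hJ.isClosed_range J.uniformContinuous
  have : CompleteSpace (LinearMap.range J.toLinearMap) :=
    IsClosed.completeSpace_coe (s := Set.range J) (hs := hclosed)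
  refine ⟨⟨LinearMap.range J.toLinearMap⟩, J.equivRange hJ.injective hclosed, fun p c hc => ?_⟩
  change ‖J p‖ ≤ c ↔ _
  rw [Prod.norm_def, max_le_iff]
  refine and_congr (BoundedContinuousFunction.norm_le hc) ?_
  change ‖ε • p‖ ≤ c ↔ _
  rw [norm_smul, Real.norm_of_nonneg hε.le]

theorem main_theorem (X : Type) [NormedAddCommGroup X] [NormedSpace ℝ X] [CompleteSpace X]
    (hinf : ¬ FiniteDimensional ℝ X) (hrefl : IsReflexiveSpace X) :
    ∃ Y : BanachSpace, IsReflexiveSpace Y.carrier ∧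
      (∃ T R : X →L[ℝ] Y.carrier,
        Module.rank ℝ (LinearMap.range (R : X →ₗ[ℝ] Y.carrier)) ≤ 1 ∧
        ‖T‖ < ‖T + R‖ ∧ ¬ NormAttains (T + R)) ∧
      ¬ CPP X Y.carrier := by
  obtain ⟨u, ψ, δ, hδ, hu, hψ1, hψ0, huψ⟩ := hrefl.exists_norm_add_weakStar_null hinf
  let r : ℕ → ℝ := fun n => 1 - 1 / ((n : ℝ) + 1)
  have hr_mono : Monotone r := fun m n hmn => sub_le_sub_left (Nat.one_div_le_one_div hmn) 1
  have hr0 (n : ℕ) : 0 ≤ r n := by simpa [r] using hr_mono (Nat.zero_le n)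
  have hr1 (n : ℕ) : r n < 1 := sub_lt_self 1 Nat.one_div_pos_of_nat
  have hr : Tendsto r atTop (𝓝 1) := by
    simpa [r] using tendsto_one_div_add_atTop_nhds_zero_nat.const_sub (1 : ℝ)
  have hpos (n : ℕ) : 0 < ‖u + ψ n‖ := by linarith [huψ n]
  let a : ℕ → ℝ := fun n => r n / ‖u + ψ n‖
  have ha0 (n : ℕ) : 0 ≤ a n := div_nonneg (hr0 n) (hpos n).le
  have haδ (n : ℕ) : a n ≤ 1 / (1 + δ) :=
    div_le_div₀ zero_le_one (hr1 n).le (by linarith) (huψ n)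
  have hδ1 : 1 / (1 + δ) < 1 := by rw [div_lt_one] <;> linarith
  have ha1 (n : ℕ) : a n ≤ 1 := (haδ n).trans hδ1.le
  have har (n : ℕ) : a n * ‖u + ψ n‖ = r n := div_mul_cancel₀ _ (hpos n).ne'
  let g : ℕ → StrongDual ℝ (X × ℝ) := fun n =>
    a n • ((ψ n).comp (ContinuousLinearMap.fst ℝ X ℝ) + ContinuousLinearMap.snd ℝ X ℝ)
  have hg_apply (n : ℕ) (x : X) (t : ℝ) : g n (x, t) = a n * (ψ n x + t) := rfl
  have hψx (n : ℕ) (x : X) : |ψ n x| ≤ ‖x‖ := by simpa [hψ1 n] using (ψ n).le_opNorm x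
  have hux (x : X) : |u x| ≤ ‖x‖ :=
    (u.le_opNorm x).trans (mul_le_of_le_one_left (norm_nonneg x) hu.le)
  have hg (n : ℕ) : ‖g n‖ ≤ 2 := by
    refine ContinuousLinearMap.opNorm_le_bound _ zero_le_two fun p => ?_
    have h1 : |ψ n p.1 + p.2| ≤ 2 * ‖p‖ := by
      have h2 := abs_add_le (ψ n p.1) p.2
      have h3 := (hψx n p.1).trans (norm_fst_le p)
      have h4 : |p.2| ≤ ‖p‖ := norm_snd_le p
      linarith
    rw [hg_apply, Real.norm_eq_abs, abs_mul, abs_of_nonneg (ha0 n)]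
    exact (mul_le_of_le_one_left (abs_nonneg _) (ha1 n)).trans h1
  obtain ⟨Y, e, he⟩ := exists_renorming g hg (ε := 1 / 4) (by norm_num)
  let T : X →L[ℝ] Y.carrier :=
    (e : X × ℝ →L[ℝ] Y.carrier).comp (ContinuousLinearMap.inl ℝ X ℝ)
  let R : X →L[ℝ] Y.carrier := u.smulRight (e (0, 1))
  have hT_apply (x : X) : T x = e (x, 0) := rfl
  have hS_apply (x : X) : (T + R) x = e (x, u x) := by
    change e (x, 0) + u x • e (0, 1) = _
    rw [← map_smul, ← map_add]
    simp
  have hT : ‖T‖ < 1 := by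
    refine (ContinuousLinearMap.opNorm_le_bound T (M := max (1 / (1 + δ)) (1 / 4))
      (by positivity) fun x => ?_).trans_lt (max_lt hδ1 (by norm_num))
    rw [hT_apply, he _ _ (by positivity)]
    refine ⟨fun n => ?_, ?_⟩
    · rw [hg_apply, add_zero, abs_mul, abs_of_nonneg (ha0 n)]
      exact mul_le_mul ((haδ n).trans (le_max_left _ _)) (hψx n x) (abs_nonneg _) (by positivity)
    · rw [Prod.norm_mk, norm_zero, max_eq_left (norm_nonneg x)]
      gcongr
      exact le_max_right _ _
  have hS : 1 ≤ ‖T + R‖ := by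
    refine le_of_tendsto' hr fun n => ?_
    rw [← har n, ← abs_of_nonneg (ha0 n), ← Real.norm_eq_abs, ← norm_smul]
    refine ContinuousLinearMap.opNorm_le_bound _ (norm_nonneg _) fun x => ?_
    refine le_trans ?_ ((T + R).le_opNorm x)
    have h := ((he (x, u x) _ (norm_nonneg _)).1 le_rfl).1 n
    rw [hS_apply]
    rwa [hg_apply, add_comm] at h
  have hSx (x : X) (hx : ‖x‖ ≤ 1) : ‖(T + R) x‖ < 1 := by
    have hux1 : |u x| ≤ ‖u‖ := u.unit_le_opNorm x hx
    have hlim : Tendsto (fun n => |ψ n x + u x|) atTop (𝓝 |u x|) := by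
      simpa using ((hψ0 x).add_const (u x)).abs
    obtain ⟨q, huq, hq⟩ := exists_between hu
    obtain ⟨N, hN⟩ := eventually_atTop.1 (hlim.eventually (gt_mem_nhds (hux1.trans_lt huq)))
    have hbound : ‖(T + R) x‖ ≤ max (max q (r N)) (1 / 4) := by
      rw [hS_apply, he _ _ (by positivity)]
      refine ⟨fun n => le_max_of_le_left ?_, le_max_of_le_right ?_⟩
      · rw [hg_apply, abs_mul, abs_of_nonneg (ha0 n)]
        rcases le_total N n with hn | hn
        · exact le_max_of_le_left
            ((mul_le_of_le_one_left (abs_nonneg _) (ha1 n)).trans (hN n hn).le)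
        · refine le_max_of_le_right (le_trans ?_ ((har n).le.trans (hr_mono hn)))
          rw [add_comm]
          exact mul_le_mul_of_nonneg_left ((u + ψ n).unit_le_opNorm x hx) (ha0 n)
      · have h : ‖(x, u x)‖ ≤ 1 := max_le hx ((hux x).trans hx)
        linarith
    exact hbound.trans_lt (max_lt (max_lt hq (hr1 N)) (by norm_num))
  have hlt : ‖T‖ < ‖T + R‖ := hT.trans_le hS
  have hatt : ¬ NormAttains (T + R) := fun ⟨x, hx, hxS⟩ =>
    absurd (hSx x hx) (not_lt.2 (hxS ▸ hS))
  have hrank : Module.rank ℝ (LinearMap.range (R : X →ₗ[ℝ] Y.carrier)) ≤ 1 := by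
    have hle : LinearMap.range (R : X →ₗ[ℝ] Y.carrier) ≤ Submodule.span ℝ {e (0, 1)} := by
      rintro _ ⟨x, rfl⟩
      exact Submodule.smul_mem _ _ (Submodule.mem_span_singleton_self _)
    exact (Submodule.rank_mono hle).trans ((rank_span_le _).trans (Cardinal.mk_singleton _).le)
  have hcompact : IsCompactOperator R :=
    IsCompactOperator.comp_clm (f := ContinuousLinearMap.toSpanSingleton ℝ (e (0, 1)))
      (isCompactOperator_of_locallyCompactSpace_rng _) u
  exact ⟨Y, hrefl.of_prod_real_equiv e, ⟨T, R, hrank, hlt, hatt⟩,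
    fun h => hatt (h T R hcompact hlt)⟩
end

section
/- Let X be an infinite-dimensional reflexive real Banach space. Then there exists a reflexive real Banach space Y such that the pair (X, Y) fails the weak maximizing property. -/
open Filter Topology

/-- A sequence converges weakly to `0` if `f (x n) → 0` for every continuous linear
functional `f`. -/
def WeaklyNull {X : Type*} [NormedAddCommGroup X] [NormedSpace ℝ X] (x : ℕ → X) : Prop :=
  ∀ f : X →L[ℝ] ℝ, Tendsto (fun n => f (x n)) atTop (nhds 0)

/-- The pair `(X, Y)` has the weak maximizing property: every operator admitting a
non-weakly-null maximizing sequence in the unit sphere attains its norm. -/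
def WMP (X Y : Type*) [NormedAddCommGroup X] [NormedSpace ℝ X]
    [NormedAddCommGroup Y] [NormedSpace ℝ Y] : Prop :=
  ∀ T : X →L[ℝ] Y,
    (∃ x : ℕ → X, (∀ n, ‖x n‖ = 1) ∧
      Tendsto (fun n => ‖T (x n)‖) atTop (nhds ‖T‖) ∧ ¬ WeaklyNull x) →
    NormAttains T

/-- A point outside a closed subspace is separated from it by a functional vanishing on the
subspace. -/
theorem exists_dual_eq_zero_of_notMem {E : Type*} [NormedAddCommGroup E] [NormedSpace ℝ E]
    (V : Submodule ℝ E) (hV : IsClosed (V : Set E)) {y : E} (hy : y ∉ V) :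
    ∃ h : E →L[ℝ] ℝ, (∀ v ∈ V, h v = 0) ∧ h y ≠ 0 := by
  obtain ⟨h, u, hyu, hu⟩ := geometric_hahn_banach_point_closed V.convex hV hy
  have hu0 : u < 0 := by simpa using hu 0 V.zero_mem
  refine ⟨h, fun v hv => ?_, (hyu.trans hu0).ne⟩
  by_contra hne
  have := hu ((u / h v) • v) (V.smul_mem _ hv)
  rw [map_smul, smul_eq_mul, div_mul_cancel₀ _ hne] at this
  exact lt_irrefl _ this

/-- Every nonzero functional almost attains its norm on the unit sphere. -/
theorem exists_norm_eq_one_lt_apply {E : Type*} [NormedAddCommGroup E] [NormedSpace ℝ E]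
    (h : E →L[ℝ] ℝ) {r : ℝ} (hr0 : 0 ≤ r) (hr : r < ‖h‖) : ∃ x : E, ‖x‖ = 1 ∧ r < h x := by
  obtain ⟨x, hx1, hx⟩ := h.exists_lt_apply_of_lt_opNorm hr
  rw [Real.norm_eq_abs] at hx
  have hpos : 0 < |h x| := hr0.trans_lt hx
  have hhx : h x ≠ 0 := abs_pos.mp hpos
  have hx0 : x ≠ 0 := by rintro rfl; simp at hhx
  have hn : 0 < ‖x‖ := norm_pos_iff.mpr hx0
  have key : r < ‖x‖⁻¹ * |h x| := by
    refine hx.trans_le ?_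
    exact le_mul_of_one_le_left hpos.le ((one_le_inv₀ hn).mpr hx1.le)
  rcases abs_cases (h x) with ⟨he, -⟩ | ⟨he, -⟩
  · refine ⟨‖x‖⁻¹ • x, by simp [norm_smul, hn.ne'], ?_⟩
    simpa [he] using key
  · refine ⟨-(‖x‖⁻¹ • x), by simp [norm_smul, hn.ne'], ?_⟩
    simpa [he] using key

/-- In a reflexive space, bounded sequences of functionals have pointwise Cauchy subsequences. -/
theorem IsReflexiveSpace.exists_subseq_cauchySeq {X : Type*} [NormedAddCommGroup X]
    [NormedSpace ℝ X] (hX : IsReflexiveSpace X) (f : ℕ → X →L[ℝ] ℝ) {R : ℝ}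
    (hf : ∀ n, ‖f n‖ ≤ R) :
    ∃ φ : ℕ → ℕ, StrictMono φ ∧ ∀ x, CauchySeq fun n => f (φ n) x := by
  set Z : Submodule ℝ (X →L[ℝ] ℝ) := (Submodule.span ℝ (Set.range f)).topologicalClosure with hZ
  have hZc : IsClosed (Z : Set (X →L[ℝ] ℝ)) := Submodule.isClosed_topologicalClosure _
  have hfZ : ∀ n, f n ∈ Z := fun n =>
    Submodule.le_topologicalClosure _ (Submodule.subset_span ⟨n, rfl⟩)
  have hsep : TopologicalSpace.IsSeparable (Z : Set (X →L[ℝ] ℝ)) := by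
    rw [hZ, Submodule.topologicalClosure_coe]
    exact ((Set.countable_range f).isSeparable.span (R := ℝ)).closure
  obtain ⟨c, hc, hZcl⟩ := hsep
  have hcne : c.Nonempty := by
    rw [← closure_nonempty_iff]
    exact ⟨0, hZcl Z.zero_mem⟩
  obtain ⟨g, rfl⟩ := hc.exists_eq_range hcne
  have hx : ∀ i, ∃ x : X, ‖x‖ ≤ 1 ∧ ‖g i‖ / 2 ≤ g i x := fun i => by
    by_cases hi : g i = 0
    · exact ⟨0, by simp [hi]⟩
    · have hpos : 0 < ‖g i‖ := norm_pos_iff.mpr hi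
      obtain ⟨x, hx1, hx⟩ := exists_norm_eq_one_lt_apply (g i) (half_pos hpos).le
        (half_lt_self hpos)
      exact ⟨x, hx1.le, hx.le⟩
  choose x hx1 hxg using hx
  have hR : 0 ≤ R := (norm_nonneg _).trans (hf 0)
  obtain ⟨L, -, φ, hφ, hL⟩ := (isCompact_univ_pi (fun _ : ℕ => isCompact_Icc
    (a := -R) (b := R))).tendsto_subseq (x := fun n i => f n (x i)) (fun n i _ => by
      rw [Set.mem_Icc, ← abs_le, ← Real.norm_eq_abs]
      exact ((f n).le_opNorm_of_le (hx1 i)).trans (by simpa using hf n))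
  rw [tendsto_pi_nhds] at hL
  refine ⟨φ, hφ, ?_⟩
  let V : Submodule ℝ X :=
    { carrier := {y | CauchySeq fun n => f (φ n) y}
      zero_mem' := by simpa using cauchySeq_const (0 : ℝ)
      add_mem' := fun {a b} ha hb => by
        simp only [Set.mem_ofPred_eq, map_add]
        exact CauchySeq.add ha hb
      smul_mem' := fun r a ha => by
        obtain ⟨l, hl⟩ := cauchySeq_tendsto_of_complete (show CauchySeq fun n => f (φ n) a from ha)
        simpa using (hl.const_mul r).cauchySeq }
  have hVc : IsClosed (V : Set X) := by
    refine isClosed_of_closure_subset fun y hy => ?_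
    change CauchySeq fun n => f (φ n) y
    rw [Metric.cauchySeq_iff]
    intro ε hε
    obtain ⟨z, hz, hyz⟩ := Metric.mem_closure_iff.mp hy (ε / (3 * (R + 1))) (by positivity)
    obtain ⟨N, hN⟩ := Metric.cauchySeq_iff.mp (show CauchySeq fun n => f (φ n) z from hz) (ε / 3)
      (by positivity)
    have hb : ∀ n, |f (φ n) y - f (φ n) z| < ε / 3 := fun n => by
      rw [← map_sub, ← Real.norm_eq_abs]
      rw [dist_eq_norm] at hyz
      calc ‖f (φ n) (y - z)‖ ≤ R * ‖y - z‖ := (f (φ n)).le_of_opNorm_le (hf _) _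
        _ ≤ (R + 1) * ‖y - z‖ := by gcongr; linarith
        _ < (R + 1) * (ε / (3 * (R + 1))) := by gcongr
        _ = ε / 3 := by field_simp
    refine ⟨N, fun m hm n hn => ?_⟩
    have h1 := hN m hm n hn
    have h2 := hb m
    have h3 := hb n
    rw [Real.dist_eq, abs_lt] at h1 ⊢
    rw [abs_lt] at h2 h3
    constructor <;> linarith [h1.1, h1.2, h2.1, h2.2, h3.1, h3.2]
  intro y
  by_contra hy
  obtain ⟨h, hV0, hhy⟩ := exists_dual_eq_zero_of_notMem V hVc (y := y) hy
  have hhZ : h ∈ Z := by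
    by_contra hh
    obtain ⟨ψ, hψ, hψh⟩ := exists_dual_eq_zero_of_notMem Z hZc hh
    obtain ⟨w, rfl⟩ := hX ψ
    refine hψh (hV0 w ?_)
    change CauchySeq fun n => f (φ n) w
    have : ∀ n, f n w = 0 := fun n => hψ _ (hfZ n)
    simpa [this] using cauchySeq_const (0 : ℝ)
  have hh0 : 0 < ‖h‖ := norm_pos_iff.mpr (by rintro rfl; simp at hhy)
  obtain ⟨_, ⟨i, rfl⟩, hi⟩ := Metric.mem_closure_iff.mp (hZcl hhZ) (‖h‖ / 4) (by positivity)
  rw [dist_eq_norm] at hi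
  have h0 : h (x i) = 0 := hV0 _ (hL i).cauchySeq
  have h1 : g i (x i) ≤ ‖h - g i‖ := by
    have := (h - g i).le_opNorm_of_le (hx1 i)
    rw [Real.norm_eq_abs, abs_le] at this
    simp only [sub_apply, h0, mul_one] at this
    linarith [this.1]
  have h2 : ‖h‖ ≤ ‖h - g i‖ + ‖g i‖ := by simpa using norm_add_le (h - g i) (g i)
  linarith [hxg i]

/-- The dual of an infinite-dimensional reflexive space contains a normalized sequence converging
pointwise to `0`. -/
theorem IsReflexiveSpace.exists_normalized_pointwise_null {X : Type*} [NormedAddCommGroup X]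
    [NormedSpace ℝ X] (hX : IsReflexiveSpace X) (hinf : ¬ FiniteDimensional ℝ X) :
    ∃ f : ℕ → X →L[ℝ] ℝ, (∀ n, ‖f n‖ = 1) ∧ ∀ x, Tendsto (fun n => f n x) atTop (𝓝 0) := by
  have hinf' : ¬ FiniteDimensional ℝ (X →L[ℝ] ℝ) := fun hfin => hinf <| by
    have : FiniteDimensional ℝ ((X →L[ℝ] ℝ) →L[ℝ] ℝ) := inferInstance
    exact FiniteDimensional.of_injective
      (NormedSpace.inclusionInDoubleDualLi ℝ (E := X)).toLinearMap
      (NormedSpace.inclusionInDoubleDualLi ℝ (E := X)).injective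
  obtain ⟨R, f, -, hfR, hf⟩ := exists_seq_norm_le_one_le_norm_sub (𝕜 := ℝ) hinf'
  obtain ⟨φ, hφ, hc⟩ := hX.exists_subseq_cauchySeq f hfR
  set d : ℕ → X →L[ℝ] ℝ := fun n => f (φ (n + 1)) - f (φ n) with hd
  have hd1 : ∀ n, 1 ≤ ‖d n‖ := fun n => hf (hφ (Nat.lt_succ_self n)).ne'
  have hd0 : ∀ n, ‖d n‖ ≠ 0 := fun n => by linarith [hd1 n]
  refine ⟨fun n => ‖d n‖⁻¹ • d n, fun n => by simp [norm_smul, hd0 n], fun x => ?_⟩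
  have hdx : Tendsto (fun n => d n x) atTop (𝓝 0) := by
    obtain ⟨l, hl⟩ := cauchySeq_tendsto_of_complete (hc x)
    simpa [hd] using (hl.comp (tendsto_add_atTop_nat 1)).sub hl
  refine squeeze_zero_norm (fun n => ?_) (by simpa using hdx.norm)
  simp only [smul_apply, norm_smul, norm_inv, norm_norm]
  exact mul_le_of_le_one_left (norm_nonneg _) (inv_le_one_of_one_le₀ (hd1 n))

/-- Reflexivity is invariant under linear homeomorphisms. -/
theorem IsReflexiveSpace.of_equiv {X Y : Type*} [NormedAddCommGroup X] [NormedSpace ℝ X]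
    [NormedAddCommGroup Y] [NormedSpace ℝ Y] (hX : IsReflexiveSpace X) (e : X ≃L[ℝ] Y) :
    IsReflexiveSpace Y := by
  intro Φ
  obtain ⟨x, hx⟩ := hX (Φ.comp ((ContinuousLinearMap.compL ℝ Y X ℝ).flip (e.symm : Y →L[ℝ] X)))
  refine ⟨e x, ?_⟩
  ext g
  have hg : (g.comp (e : X →L[ℝ] Y)).comp (e.symm : Y →L[ℝ] X) = g := by ext y; simp
  have := DFunLike.congr_fun hx (g.comp (e : X →L[ℝ] Y))
  simpa [hg] using this

/-- An operator bounded below with a maximizing sequence that is not weakly null and which does not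
attain its norm yields, by restricting the codomain to the range, a reflexive codomain for which the
weak maximizing property fails. -/
theorem IsReflexiveSpace.exists_not_WMP_of_antilipschitz {X E : Type} [NormedAddCommGroup X]
    [NormedSpace ℝ X] [CompleteSpace X] [NormedAddCommGroup E] [NormedSpace ℝ E] [CompleteSpace E]
    (hX : IsReflexiveSpace X) (T : X →L[ℝ] E) {K : NNReal} (hT : AntilipschitzWith K T)
    (hmax : ∃ x : ℕ → X, (∀ n, ‖x n‖ = 1) ∧
      Tendsto (fun n => ‖T (x n)‖) atTop (𝓝 ‖T‖) ∧ ¬ WeaklyNull x)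
    (hna : ¬ NormAttains T) :
    ∃ Y : BanachSpace, IsReflexiveSpace Y.carrier ∧ ¬ WMP X Y.carrier := by
  have hclosed : IsClosed (Set.range T) := hT.isClosed_range T.uniformContinuous
  let e := T.equivRange hT.injective hclosed
  have : CompleteSpace (LinearMap.range (T : X →ₗ[ℝ] E)) :=
    IsClosed.completeSpace_coe (hs := hclosed)
  let T' : X →L[ℝ] LinearMap.range (T : X →ₗ[ℝ] E) := e
  have hnorm : ‖T'‖ = ‖T‖ := ContinuousLinearMap.opNorm_ext T' T fun z => rfl
  refine ⟨⟨LinearMap.range (T : X →ₗ[ℝ] E)⟩, hX.of_equiv e, fun hW => hna ?_⟩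
  obtain ⟨x, hx, hlim, hnull⟩ := hmax
  obtain ⟨z, hz, hTz⟩ := hW T' ⟨x, hx, hnorm.symm ▸ hlim, hnull⟩
  exact ⟨z, hz, hTz.trans hnorm⟩

/-- If functionals in the dual unit ball are almost attained along a sequence that is not weakly
null, but asymptotically stay below `1` at every point of the unit ball, then some reflexive
codomain witnesses the failure of the weak maximizing property. -/
theorem IsReflexiveSpace.exists_not_WMP_of_functionals {X : Type} [NormedAddCommGroup X]
    [NormedSpace ℝ X] [CompleteSpace X] (hX : IsReflexiveSpace X) (h : ℕ → X →L[ℝ] ℝ)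
    (hh : ∀ n, ‖h n‖ ≤ 1) (x : ℕ → X) (hx : ∀ n, ‖x n‖ = 1)
    (hlim : Tendsto (fun n => h n (x n)) atTop (𝓝 1)) (hnull : ¬ WeaklyNull x)
    (hlt : ∀ z, ‖z‖ ≤ 1 → ∃ c < 1, ∀ᶠ n in atTop, |h n z| ≤ c) :
    ∃ Y : BanachSpace, IsReflexiveSpace Y.carrier ∧ ¬ WMP X Y.carrier := by
  set a : ℕ → ℝ := fun n => 1 - 1 / ((n : ℝ) + 1) with ha
  have ha0 : ∀ n, 0 ≤ a n := fun n => by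
    have : 1 / ((n : ℝ) + 1) ≤ 1 := by
      rw [div_le_one (by positivity)]
      linarith [n.cast_nonneg (α := ℝ)]
    simpa [ha] using this
  have ha1 : ∀ n, a n < 1 := fun n => by
    have : 0 < 1 / ((n : ℝ) + 1) := by positivity
    simp only [ha]
    linarith
  have hmono : Monotone a := fun m n hmn => by
    have : (m : ℝ) ≤ n := by exact_mod_cast hmn
    simp only [ha]
    gcongr
  have halim : Tendsto a atTop (𝓝 1) := by
    simpa [ha] using tendsto_one_div_add_atTop_nhds_zero_nat.const_sub (1 : ℝ)
  have hhz : ∀ n z, |h n z| ≤ ‖z‖ := fun n z => by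
    simpa using (h n).le_of_opNorm_le (hh n) z
  have hbound : ∀ z n, ‖a n * h n z‖ ≤ ‖z‖ := fun z n => by
    rw [norm_mul, Real.norm_of_nonneg (ha0 n), Real.norm_eq_abs]
    exact (mul_le_of_le_one_left (abs_nonneg _) (ha1 n).le).trans (hhz n z)
  let S : X →L[ℝ] BoundedContinuousFunction ℕ ℝ := LinearMap.mkContinuous
    { toFun := fun z => BoundedContinuousFunction.ofNormedAddCommGroup (fun n => a n * h n z)
        continuous_of_discreteTopology ‖z‖ (hbound z)
      map_add' := fun y z => by ext n; simp [mul_add]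
      map_smul' := fun r z => by ext n; simp [mul_left_comm] } 1 (fun z => by
        simpa using BoundedContinuousFunction.norm_ofNormedAddCommGroup_le _ (norm_nonneg z)
          (hbound z))
  have hS : ∀ z n, S z n = a n * h n z := fun _ _ => rfl
  let T : X →L[ℝ] X × BoundedContinuousFunction ℕ ℝ :=
    ((1 / 2 : ℝ) • ContinuousLinearMap.id ℝ X).prod S
  have hT : ∀ z, ‖T z‖ = max (‖z‖ / 2) ‖S z‖ := fun z => by
    change max ‖(1 / 2 : ℝ) • z‖ ‖S z‖ = _
    rw [norm_smul]
    congr 1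
    norm_num
    ring
  have hSle : ∀ z, ‖S z‖ ≤ ‖z‖ := fun z =>
    (BoundedContinuousFunction.norm_le (norm_nonneg z)).mpr (hbound z)
  have hanti : AntilipschitzWith 2 T := AddMonoidHomClass.antilipschitz_of_bound T fun z => by
    have := (hT z).symm ▸ le_max_left (‖z‖ / 2) ‖S z‖
    push_cast
    linarith
  have hle : ‖T‖ ≤ 1 := T.opNorm_le_bound zero_le_one fun z => by
    rw [hT, one_mul]
    exact max_le (by linarith [norm_nonneg z]) (hSle z)
  have hlow : ∀ n, a n * h n (x n) ≤ ‖T (x n)‖ := fun n => by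
    rw [hT, ← hS]
    exact (le_abs_self _).trans (((S (x n)).norm_coe_le_norm n).trans (le_max_right _ _))
  have hup : ∀ n, ‖T (x n)‖ ≤ ‖T‖ := fun n => by simpa [hx n] using T.le_opNorm (x n)
  have hlim' : Tendsto (fun n => a n * h n (x n)) atTop (𝓝 1) := by simpa using halim.mul hlim
  have hnorm : ‖T‖ = 1 := le_antisymm hle
    (le_of_tendsto' hlim' fun n => (hlow n).trans (hup n))
  refine hX.exists_not_WMP_of_antilipschitz T hanti ⟨x, hx, ?_, hnull⟩ ?_
  · rw [hnorm]
    exact tendsto_of_tendsto_of_tendsto_of_le_of_le hlim' tendsto_const_nhds hlow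
      fun n => (hup n).trans hle
  rintro ⟨z, hz, hTz⟩
  obtain ⟨c, hc1, hc⟩ := hlt z hz
  obtain ⟨N, hN⟩ := eventually_atTop.mp hc
  have hSz : ‖S z‖ ≤ max c (a N) := by
    refine (BoundedContinuousFunction.norm_le ((ha0 N).trans (le_max_right _ _))).mpr fun n => ?_
    rw [hS, norm_mul, Real.norm_of_nonneg (ha0 n), Real.norm_eq_abs]
    rcases le_total N n with hn | hn
    · exact (mul_le_of_le_one_left (abs_nonneg _) (ha1 n).le).trans
        ((hN n hn).trans (le_max_left _ _))
    · exact (mul_le_of_le_one_right (ha0 n) ((hhz n z).trans hz)).trans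
        ((hmono hn).trans (le_max_right _ _))
  have : ‖T z‖ < 1 := by
    rw [hT]
    exact max_lt (by linarith) (hSz.trans_lt (max_lt hc1 (ha1 N)))
  exact this.ne (hTz.trans hnorm)

/-- A pointwise null sequence of functionals almost attained along a weakly null sequence cannot
have `c₀`-like translates: some translate of a functional of norm below `2` has norm at
least `2` infinitely often. -/
theorem exists_frequently_two_le_norm_add {X : Type*} [NormedAddCommGroup X] [NormedSpace ℝ X]
    (f : ℕ → X →L[ℝ] ℝ) (hf : ∀ z, Tendsto (fun n => f n z) atTop (𝓝 0)) (x : ℕ → X)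
    (hx : WeaklyNull x) (hlim : Tendsto (fun n => f n (x n)) atTop (𝓝 1)) :
    ∃ g : X →L[ℝ] ℝ, ‖g‖ < 2 ∧ ∃ᶠ n in atTop, 2 ≤ ‖f n + g‖ := by
  by_contra! hcon
  let State := {p : Finset ℕ × (X →L[ℝ] ℝ) // ‖p.2‖ < 2 ∧ ∀ i ∈ p.1, 1 / 2 < p.2 (x i)}
  have hstep : ∀ (k : ℕ) (p : State), ∃ q : State, p.1.1 ⊆ q.1.1 ∧ ∃ n ≥ k, n ∈ q.1.1 := by
    rintro k ⟨⟨F, g⟩, hg, hF⟩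
    have h1 : ∀ᶠ n in atTop, ‖f n + g‖ < 2 := by simpa using hcon g hg
    have h2 : ∀ᶠ n in atTop, ∀ i ∈ F, 1 / 2 < (f n + g) (x i) := by
      rw [Filter.eventually_all_finset]
      intro i hi
      have : Tendsto (fun n => (f n + g) (x i)) atTop (𝓝 (g (x i))) := by
        simpa using (hf (x i)).add_const (g (x i))
      exact this.eventually_const_lt (hF i hi)
    have h3 : ∀ᶠ n in atTop, 1 / 2 < (f n + g) (x n) := by
      have : Tendsto (fun n => (f n + g) (x n)) atTop (𝓝 1) := by
        simpa using hlim.add (hx g)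
      exact this.eventually_const_lt (by norm_num)
    obtain ⟨n, h1, h2, h3, hn⟩ := (h1.and (h2.and (h3.and (eventually_ge_atTop k)))).exists
    exact ⟨⟨⟨insert n F, f n + g⟩, h1, by simpa using ⟨by simpa using h3, by simpa using h2⟩⟩,
      Finset.subset_insert _ _, n, hn, Finset.mem_insert_self _ _⟩
  choose step hsub hmem using hstep
  let s : ℕ → State := fun k => Nat.rec ⟨(∅, 0), by simp⟩ step k
  have hs : ∀ k, s (k + 1) = step k (s k) := fun _ => rfl
  have hsmono : Monotone fun k => (s k).1.1 := monotone_nat_of_le_succ fun k => hs k ▸ hsub k (s k)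
  let G : ℕ → WeakDual ℝ X := fun k => StrongDual.toWeakDual (s k).1.2
  let U : Ultrafilter ℕ := Filter.hyperfilter ℕ
  have hU : (U : Filter ℕ) ≤ atTop := Nat.hyperfilter_le_atTop
  obtain ⟨g, -, hg⟩ := (WeakDual.isCompact_closedBall (0 : X →L[ℝ] ℝ) 2).ultrafilter_le_nhds
    (U.map G) (by
      rw [le_principal_iff]
      refine Filter.univ_mem' (f := (U : Filter ℕ)) fun k => ?_
      simpa [G] using (s k).2.1.le)
  have hgx : ∀ z, Tendsto (fun k => (s k).1.2 z) U (𝓝 (g z)) := fun z =>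
    ((WeakDual.eval_continuous z).tendsto g).comp hg
  have hge : ∀ k, ∀ i ∈ (s k).1.1, 1 / 2 ≤ g (x i) := fun k i hi =>
    ge_of_tendsto (hgx (x i)) <| hU <| (eventually_ge_atTop k).mono fun m hm =>
      ((s m).2.2 i (hsmono hm hi)).le
  obtain ⟨N, hN⟩ := eventually_atTop.mp
    ((hx (WeakDual.toStrongDual g)).eventually_lt_const (by norm_num : (0 : ℝ) < 1 / 2))
  obtain ⟨n, hn, hns⟩ := hmem N (s N)
  exact absurd (hge (N + 1) n (hs N ▸ hns)) (not_le.mpr (hN n hn))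

/-- Unit vectors along which given norm-one functionals are asymptotically attained. -/
theorem exists_unit_seq_tendsto_apply {X : Type*} [NormedAddCommGroup X] [NormedSpace ℝ X]
    (f : ℕ → X →L[ℝ] ℝ) (hf : ∀ n, ‖f n‖ = 1) :
    ∃ x : ℕ → X, (∀ n, ‖x n‖ = 1) ∧ Tendsto (fun n => f n (x n)) atTop (𝓝 1) := by
  have : ∀ n : ℕ, ∃ x : X, ‖x‖ = 1 ∧ 1 - 1 / ((n : ℝ) + 1) < f n x := fun n => by
    refine exists_norm_eq_one_lt_apply (f n) ?_ ?_
    · rw [sub_nonneg, div_le_one (by positivity)]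
      linarith [n.cast_nonneg (α := ℝ)]
    · rw [hf n]
      have : 0 < 1 / ((n : ℝ) + 1) := by positivity
      linarith
  choose x hx hfx using this
  refine ⟨x, hx, tendsto_of_tendsto_of_tendsto_of_le_of_le
    (by simpa using tendsto_one_div_add_atTop_nhds_zero_nat.const_sub (1 : ℝ))
    tendsto_const_nhds (fun n => (hfx n).le) fun n => ?_⟩
  simpa [hf n, hx n] using (le_abs_self _).trans ((f n).le_opNorm (x n))

theorem fail_WMP (X : Type) [NormedAddCommGroup X] [NormedSpace ℝ X] [CompleteSpace X]
    (hinf : ¬ FiniteDimensional ℝ X) (hrefl : IsReflexiveSpace X) :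
    ∃ Y : BanachSpace, IsReflexiveSpace Y.carrier ∧ ¬ WMP X Y.carrier := by
  obtain ⟨f, hf1, hf⟩ := hrefl.exists_normalized_pointwise_null hinf
  obtain ⟨x, hx, hfx⟩ := exists_unit_seq_tendsto_apply f hf1
  by_cases hnull : WeaklyNull x
  swap
  · refine hrefl.exists_not_WMP_of_functionals f (fun n => (hf1 n).le) x hx hfx hnull
      fun z _ => ⟨1 / 2, by norm_num, ?_⟩
    exact ((hf z).abs.eventually_lt_const (by norm_num)).mono fun n hn => hn.le
  obtain ⟨g, hg, hfreq⟩ := exists_frequently_two_le_norm_add f hf x hnull hfx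
  obtain ⟨φ, hφ, hφg⟩ := extraction_of_frequently_atTop hfreq
  have hfφ : ∀ z, Tendsto (fun n => f (φ n) z) atTop (𝓝 0) := fun z =>
    (hf z).comp hφ.tendsto_atTop
  set r : ℕ → ℝ := fun n => ‖f (φ n) + g‖ with hr
  have hr0 : ∀ n, 0 < r n := fun n => two_pos.trans_le (hφg n)
  set h : ℕ → X →L[ℝ] ℝ := fun n => (r n)⁻¹ • (f (φ n) + g) with hh
  have hh1 : ∀ n, ‖h n‖ = 1 := fun n => by
    simp only [hh, norm_smul, norm_inv, Real.norm_of_nonneg (hr0 n).le]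
    exact inv_mul_cancel₀ (hr0 n).ne'
  have hle : ∀ n z, |h n z| ≤ (|f (φ n) z| + |g z|) / 2 := fun n z => by
    have : |h n z| = |f (φ n) z + g z| / r n := by
      simp [hh, ← mul_add, abs_mul, abs_of_pos (hr0 n), div_eq_inv_mul]
    rw [this]
    exact div_le_div₀ (by positivity) (abs_add_le _ _) two_pos (hφg n)
  obtain ⟨u, hu, hhu⟩ := exists_unit_seq_tendsto_apply h hh1
  refine hrefl.exists_not_WMP_of_functionals h (fun n => (hh1 n).le) u hu hhu (fun hunull => ?_)
    fun z hz => ?_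
  · have hlim : Tendsto (fun n => (1 + |g (u n)|) / 2) atTop (𝓝 (1 / 2)) := by
      simpa using ((hunull g).abs.const_add 1).div_const 2
    have : (1 : ℝ) ≤ 1 / 2 := le_of_tendsto_of_tendsto' hhu hlim fun n => by
      have hfu : |f (φ n) (u n)| ≤ 1 := by simpa [hf1, hu n] using (f (φ n)).le_opNorm (u n)
      linarith [le_abs_self (h n (u n)), hle n (u n)]
    norm_num at this
  · have hgz : |g z| < 2 := by
      have := g.le_opNorm_of_le hz
      rw [Real.norm_eq_abs, mul_one] at this
      exact this.trans_lt hg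
    have hlim : Tendsto (fun n => (|f (φ n) z| + |g z|) / 2) atTop (𝓝 (|g z| / 2)) := by
      simpa using ((hfφ z).abs.add_const |g z|).div_const 2
    refine ⟨(|g z| / 2 + 1) / 2, by linarith, ?_⟩
    exact (hlim.eventually_lt_const (by linarith)).mono fun n hn => (hle n z).trans hn.le
end

section
/- Let X be an infinite-dimensional reflexive real Banach space. Then there exist bounded linear operators S, R : X → ℓ∞ such that R has rank at most one, ‖S‖ = 1, ‖S + R‖ > ‖S‖, and S + R does not attain its norm. -/
open Filter Topology
open scoped ENNReal

section Dual

variable {X : Type*} [NormedAddCommGroup X] [NormedSpace ℝ X]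

/-- A point outside a closed subspace is separated from it by a functional vanishing on the
subspace. -/
theorem exists_dual_vanishing_of_notMem {p : Submodule ℝ X} (hp : IsClosed (p : Set X))
    {x : X} (hx : x ∉ p) : ∃ f : StrongDual ℝ X, (∀ a ∈ p, f a = 0) ∧ f x ≠ 0 := by
  obtain ⟨f, u, hu, hux⟩ := geometric_hahn_banach_closed_point p.convex hp hx
  have hf : ∀ a ∈ p, f a = 0 := by
    intro a ha
    by_contra hne
    have h := hu ((u / f a) • a) (p.smul_mem _ ha)
    rw [map_smul, smul_eq_mul, div_mul_cancel₀ _ hne] at h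
    exact lt_irrefl _ h
  refine ⟨f, hf, ?_⟩
  have h0 := hu 0 p.zero_mem
  rw [map_zero] at h0
  exact (h0.trans hux).ne'

/-- In infinite dimension, any finite set is annihilated by a functional of prescribed norm. -/
theorem exists_norm_eq_vanishing_on_finset (hinf : ¬ FiniteDimensional ℝ X) (G : Finset X)
    {r : ℝ} (hr : 0 ≤ r) : ∃ e : StrongDual ℝ X, (∀ x ∈ G, e x = 0) ∧ ‖e‖ = r := by
  have hfin : FiniteDimensional ℝ (Submodule.span ℝ (G : Set X)) :=
    FiniteDimensional.span_finset ℝ G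
  obtain ⟨x, hx⟩ : ∃ x, x ∉ Submodule.span ℝ (G : Set X) := by
    by_contra! hall
    refine hinf ?_
    have htop : Submodule.span ℝ (G : Set X) = ⊤ := Submodule.eq_top_iff'.2 hall
    rw [htop] at hfin
    exact Module.Finite.equiv (Submodule.topEquiv (R := ℝ) (M := X))
  obtain ⟨f, hf, hfx⟩ :=
    exists_dual_vanishing_of_notMem (Submodule.closed_of_finiteDimensional _) hx
  have hf0 : f ≠ 0 := by
    rintro rfl
    simp at hfx
  refine ⟨(r / ‖f‖) • f, fun y hy => ?_, ?_⟩
  · simp [hf y (Submodule.subset_span hy)]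
  · rw [norm_smul, norm_div, norm_norm, div_mul_cancel₀ _ (norm_ne_zero_iff.2 hf0),
      Real.norm_of_nonneg hr]

/-- `G` norms `V` up to a factor `2`. -/
def NormsUpToTwo (G : Finset X) (V : Submodule ℝ (StrongDual ℝ X)) : Prop :=
  ∀ v ∈ V, ∃ x ∈ G, ‖x‖ ≤ 1 ∧ ‖v‖ ≤ 2 * ‖v x‖

theorem exists_normsUpToTwo (V : Submodule ℝ (StrongDual ℝ X)) [FiniteDimensional ℝ V] :
    ∃ G : Finset X, NormsUpToTwo G V := by
  classical
  have : ProperSpace V := FiniteDimensional.proper ℝ V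
  obtain ⟨t, ht⟩ := (isCompact_sphere (0 : V) 1).elim_finite_subcover
    (fun x : Metric.closedBall (0 : X) 1 => {v : V | 1 / 2 < ‖(v : StrongDual ℝ X) x‖})
    (fun x => isOpen_lt continuous_const (by fun_prop)) (by
      intro v hv
      have hv1 : ‖(v : StrongDual ℝ X)‖ = 1 := mem_sphere_zero_iff_norm.1 hv
      by_contra hcon
      simp only [Set.mem_iUnion, Set.mem_ofPred_eq, not_exists, not_lt] at hcon
      have : ‖(v : StrongDual ℝ X)‖ ≤ 1 / 2 :=
        ContinuousLinearMap.opNorm_le_of_unit_norm (by norm_num)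
          (fun x hx => hcon ⟨x, by simp [hx]⟩)
      linarith)
  refine ⟨insert 0 (t.image Subtype.val), fun v hv => ?_⟩
  by_cases hv0 : v = 0
  · exact ⟨0, by simp, by simp, by simp [hv0]⟩
  have hpos : 0 < ‖v‖ := norm_pos_iff.2 hv0
  have hmem : (⟨‖v‖⁻¹ • v, V.smul_mem _ hv⟩ : V) ∈ Metric.sphere (0 : V) 1 := by
    refine (mem_sphere_zero_iff_norm (E := V)).2 ?_
    rw [Submodule.coe_norm, norm_smul, norm_inv, norm_norm, inv_mul_cancel₀ hpos.ne']
  obtain ⟨x, hxt, hx⟩ := Set.mem_iUnion₂.1 (ht hmem)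
  refine ⟨x, Finset.mem_insert_of_mem (Finset.mem_image_of_mem _ hxt),
    mem_closedBall_zero_iff.1 x.2, ?_⟩
  have hx' : 1 / 2 < ‖v‖⁻¹ * ‖v (x : X)‖ := by simpa [norm_smul] using hx
  rw [inv_mul_eq_div, lt_div_iff₀ hpos] at hx'
  linarith

/-- Successive perturbations by functionals that vanish on finite sets norming everything
constructed so far. -/
theorem exists_seq_increments (D : ℕ → StrongDual ℝ X → StrongDual ℝ X → Prop)
    (h₀ : StrongDual ℝ X)
    (hD : ∀ k h (G : Finset X), ∃ e : StrongDual ℝ X, (∀ x ∈ G, e x = 0) ∧ D k h e) :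
    ∃ (h : ℕ → StrongDual ℝ X) (G : ℕ → Finset X), h 0 = h₀ ∧
      (∀ k, D k (h k) (h (k + 1) - h k)) ∧
      (∀ k m, k ≤ m → ∀ x ∈ G k, h m x = h k x) ∧
      (∀ k, NormsUpToTwo (G k) (Submodule.span ℝ (h '' Set.Iic k))) := by
  classical
  let State := {s : StrongDual ℝ X × Finset X × Submodule ℝ (StrongDual ℝ X) //
    s.1 ∈ s.2.2 ∧ FiniteDimensional ℝ s.2.2 ∧ NormsUpToTwo s.2.1 s.2.2}
  have hstep : ∀ (k : ℕ) (s : State), ∃ s' : State,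
      D k s.1.1 (s'.1.1 - s.1.1) ∧ (∀ x ∈ s.1.2.1, s'.1.1 x = s.1.1 x) ∧
      s.1.2.1 ⊆ s'.1.2.1 ∧ s.1.2.2 ≤ s'.1.2.2 := by
    rintro k ⟨⟨h, G, V⟩, hV, hfin, hG⟩
    dsimp only at hV hfin hG
    obtain ⟨e, he, hDe⟩ := hD k h G
    obtain ⟨G', hG'⟩ := exists_normsUpToTwo (V ⊔ Submodule.span ℝ {h + e})
    refine ⟨⟨⟨h + e, G ∪ G', V ⊔ Submodule.span ℝ {h + e}⟩, ?_, ?_, ?_⟩, ?_, ?_, ?_, ?_⟩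
    · exact Submodule.mem_sup_right (Submodule.mem_span_singleton_self _)
    · dsimp only
      infer_instance
    · intro v hv
      obtain ⟨x, hx, hx'⟩ := hG' v hv
      exact ⟨x, Finset.mem_union_right _ hx, hx'⟩
    · simpa using hDe
    · intro x hx
      simp [he x hx]
    · exact Finset.subset_union_left
    · exact le_sup_left
  choose next hnext using hstep
  obtain ⟨G₀, hG₀⟩ := exists_normsUpToTwo (Submodule.span ℝ {h₀})
  let s₀ : State := ⟨⟨h₀, G₀, Submodule.span ℝ {h₀}⟩, Submodule.mem_span_singleton_self _,
    by dsimp only; infer_instance, hG₀⟩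
  let s : ℕ → State := fun n => Nat.rec s₀ next n
  have hs : ∀ k, s (k + 1) = next k (s k) := fun _ => rfl
  have hGmono : Monotone fun k => (s k).1.2.1 := monotone_nat_of_le_succ fun k => by
    rw [hs]
    exact (hnext k (s k)).2.2.1
  have hVmono : Monotone fun k => (s k).1.2.2 := monotone_nat_of_le_succ fun k => by
    rw [hs]
    exact (hnext k (s k)).2.2.2
  refine ⟨fun k => (s k).1.1, fun k => (s k).1.2.1, rfl, fun k => (hnext k (s k)).1, ?_, ?_⟩
  · intro k m hkm x hx
    induction m, hkm using Nat.le_induction with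
    | base => rfl
    | succ m hkm ih => exact ((hnext m (s m)).2.1 x (hGmono hkm hx)).trans ih
  · intro k v hv
    refine (s k).2.2.2 v (Submodule.span_le.2 ?_ hv)
    rintro _ ⟨j, hj, rfl⟩
    exact hVmono hj (s j).2.1

/-- Over a reflexive space, pointwise limits along ultrafilters of bounded sequences of
functionals exist and lie in the norm-closed span of the sequence. -/
theorem IsReflexiveSpace.exists_ultrafilter_limit (hrefl : IsReflexiveSpace X)
    {f : ℕ → StrongDual ℝ X} {C : ℝ} (hf : ∀ n, ‖f n‖ ≤ C) (U : Ultrafilter ℕ) :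
    ∃ s ∈ (Submodule.span ℝ (Set.range f)).topologicalClosure,
      ∀ x, Tendsto (fun n => f n x) U (𝓝 (s x)) := by
  obtain ⟨s, -, hs⟩ := (WeakDual.isCompact_closedBall (𝕜 := ℝ) (E := X) 0 C).ultrafilter_le_nhds
    (U.map fun n => StrongDual.toWeakDual (f n)) (by
      rw [Ultrafilter.coe_map, le_principal_iff, mem_map]
      exact Filter.univ_mem' fun n => by simpa using hf n)
  have hlim : ∀ x, Tendsto (fun n => f n x) U (𝓝 (WeakDual.toStrongDual s x)) := fun x =>
    ((WeakDual.eval_continuous x).tendsto s).comp hs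
  refine ⟨WeakDual.toStrongDual s, ?_, hlim⟩
  by_contra hmem
  obtain ⟨Φ, hΦ, hne⟩ :=
    exists_dual_vanishing_of_notMem (Submodule.isClosed_topologicalClosure _) hmem
  obtain ⟨x, rfl⟩ := hrefl Φ
  refine hne (tendsto_nhds_unique (hlim x) ?_)
  have h0 : ∀ n, f n x = 0 := fun n =>
    hΦ (f n) (Submodule.le_topologicalClosure _ (Submodule.subset_span ⟨n, rfl⟩))
  simp only [h0]
  exact tendsto_const_nhds

/-- An element of the closed span is the norm limit of elements of the partial spans agreeing
with it on norming sets. -/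
theorem tendsto_of_eqOn_norming {h : ℕ → StrongDual ℝ X} {G : ℕ → Finset X}
    (hG : ∀ k, NormsUpToTwo (G k) (Submodule.span ℝ (h '' Set.Iic k)))
    {s : StrongDual ℝ X} (hs : s ∈ (Submodule.span ℝ (Set.range h)).topologicalClosure)
    {v : ℕ → StrongDual ℝ X} (hv : ∀ k, v k ∈ Submodule.span ℝ (h '' Set.Iic k))
    (hvs : ∀ k, ∀ x ∈ G k, s x = v k x) : Tendsto v atTop (𝓝 s) := by
  rw [Metric.tendsto_atTop]
  intro ε hε
  obtain ⟨w, hw, hws⟩ := Metric.mem_closure_iff.1 hs (ε / 3) (by positivity)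
  have hmono : Monotone fun k : ℕ => Submodule.span ℝ (h '' Set.Iic k) := fun i j hij =>
    Submodule.span_mono (Set.image_mono (Set.Iic_subset_Iic.2 hij))
  obtain ⟨N, hN⟩ : ∃ N, w ∈ Submodule.span ℝ (h '' Set.Iic N) := by
    rw [← Submodule.mem_iSup_of_directed _ hmono.directed_le]
    refine Submodule.span_le.2 ?_ hw
    rintro _ ⟨n, rfl⟩
    exact Submodule.mem_iSup_of_mem n (Submodule.subset_span ⟨n, Set.mem_Iic.2 le_rfl, rfl⟩)
  refine ⟨N, fun k hk => ?_⟩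
  obtain ⟨x, hxG, hx1, hx⟩ := hG k (v k - w) (Submodule.sub_mem _ (hv k) (hmono hk hN))
  rw [dist_eq_norm] at hws ⊢
  have h1 : ‖(v k - w) x‖ ≤ ‖s - w‖ := by
    have : (v k - w) x = (s - w) x := by simp [hvs k x hxG]
    rw [this]
    exact (s - w).unit_le_opNorm x hx1
  calc ‖v k - s‖ = ‖(v k - w) - (s - w)‖ := by congr 1; abel
    _ ≤ ‖v k - w‖ + ‖s - w‖ := norm_sub_le _ _
    _ < ε := by linarith

/-- In the dual of a reflexive space some functional has its norm uniformly increased by every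
perturbation of norm `1 / 2` vanishing on a suitable finite set. -/
theorem IsReflexiveSpace.exists_norm_increasing (hinf : ¬ FiniteDimensional ℝ X)
    (hrefl : IsReflexiveSpace X) :
    ∃ (h : StrongDual ℝ X) (δ : ℝ) (G : Finset X), 1 ≤ ‖h‖ ∧ 0 < δ ∧
      ∀ e : StrongDual ℝ X, (∀ x ∈ G, e x = 0) → ‖e‖ = 1 / 2 → ‖h‖ + δ ≤ ‖h + e‖ := by
  by_contra! hcon
  obtain ⟨h₀, -, hh₀⟩ := exists_norm_eq_vanishing_on_finset hinf ∅ (zero_le_two (α := ℝ))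
  obtain ⟨h, G, h0, hD, hGeq, hG⟩ := exists_seq_increments
    (fun k h e => 1 ≤ ‖h‖ → ‖e‖ = 1 / 2 ∧ ‖h + e‖ < ‖h‖ + (1 / 2) ^ k) h₀ (by
      intro k h G
      by_cases hh : 1 ≤ ‖h‖
      · obtain ⟨e, he, hn, hlt⟩ := hcon h ((1 / 2) ^ k) G hh (by positivity)
        exact ⟨e, he, fun _ => ⟨hn, hlt⟩⟩
      · exact ⟨0, by simp, fun h' => absurd h' hh⟩)
  have hge : ∀ k, 1 ≤ ‖h k‖ := by
    intro k
    obtain ⟨x, hxG, hx1, hx⟩ := hG 0 (h 0) (Submodule.subset_span ⟨0, by simp, rfl⟩)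
    rw [h0, hh₀, ← h0, ← hGeq 0 k k.zero_le x hxG] at hx
    linarith [(h k).unit_le_opNorm x hx1]
  have hbound : ∀ k, ‖h k‖ ≤ 4 - 2 * (1 / 2) ^ k := by
    intro k
    induction k with
    | zero => rw [h0, hh₀]; norm_num
    | succ k ih =>
      have := (hD k (hge k)).2
      rw [add_sub_cancel] at this
      rw [pow_succ]
      linarith
  obtain ⟨s, hs, hlim⟩ := hrefl.exists_ultrafilter_limit (f := h) (C := 4)
    (fun k => (hbound k).trans (by simp)) (hyperfilter ℕ)
  have hle : ((hyperfilter ℕ : Ultrafilter ℕ) : Filter ℕ) ≤ atTop := Nat.hyperfilter_le_atTop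
  have hconv : Tendsto h atTop (𝓝 s) := by
    refine tendsto_of_eqOn_norming hG hs
      (fun k => Submodule.subset_span ⟨k, Set.mem_Iic.2 le_rfl, rfl⟩) fun k x hx => ?_
    refine tendsto_nhds_unique (hlim x) (tendsto_const_nhds.congr' ?_)
    filter_upwards [hle (eventually_ge_atTop k)] with m hm using (hGeq k m hm x hx).symm
  have hdiff := ((hconv.comp (tendsto_add_atTop_nat 1)).sub hconv).norm
  simp only [Function.comp_apply, sub_self, norm_zero, (hD _ (hge _)).1] at hdiff
  have := tendsto_nhds_unique hdiff tendsto_const_nhds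
  norm_num at this

/-- In the dual of a reflexive infinite-dimensional space there are weakly null sequences of
norm `1 / 2` vanishing on a given finite set. -/
theorem IsReflexiveSpace.exists_weakly_null (hinf : ¬ FiniteDimensional ℝ X)
    (hrefl : IsReflexiveSpace X) (G₀ : Finset X) :
    ∃ e : ℕ → StrongDual ℝ X, (∀ n, ∀ x ∈ G₀, e n x = 0) ∧ (∀ n, ‖e n‖ = 1 / 2) ∧
      ∀ x, Tendsto (fun n => e n x) atTop (𝓝 0) := by
  classical
  obtain ⟨h, G, -, hD, hGeq, hG⟩ := exists_seq_increments (X := X)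
    (fun _ _ e => (∀ x ∈ G₀, e x = 0) ∧ ‖e‖ = 1 / 2) 0 (by
      intro _ _ G
      obtain ⟨e, he, hn⟩ := exists_norm_eq_vanishing_on_finset hinf (G ∪ G₀)
        (r := 1 / 2) (by norm_num)
      exact ⟨e, fun x hx => he x (Finset.mem_union_left _ hx),
        fun x hx => he x (Finset.mem_union_right _ hx), hn⟩)
  refine ⟨fun n => h (n + 1) - h n, fun n => (hD n).1, fun n => (hD n).2, fun x => ?_⟩
  rw [tendsto_iff_ultrafilter]
  intro U hU
  obtain ⟨s, hs, hlim⟩ := hrefl.exists_ultrafilter_limit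
    (f := fun n => h (n + 1) - h n) (fun n => (hD n).2.le) U
  have hs' : s ∈ (Submodule.span ℝ (Set.range h)).topologicalClosure := by
    refine Submodule.topologicalClosure_mono (Submodule.span_le.2 ?_) hs
    rintro _ ⟨n, rfl⟩
    exact Submodule.sub_mem _ (Submodule.subset_span ⟨_, rfl⟩) (Submodule.subset_span ⟨_, rfl⟩)
  have hzero : Tendsto (fun _ : ℕ => (0 : StrongDual ℝ X)) atTop (𝓝 s) := by
    refine tendsto_of_eqOn_norming hG hs' (fun _ => Submodule.zero_mem _) fun k y hy => ?_
    refine tendsto_nhds_unique (hlim y) (tendsto_const_nhds.congr' ?_)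
    filter_upwards [hU (eventually_ge_atTop k)] with m hm
    simp [hGeq k m hm y hy, hGeq k (m + 1) (hm.trans m.le_succ) y hy]
  have := hlim x
  rwa [tendsto_nhds_unique hzero tendsto_const_nhds] at this

/-- A bounded sequence of functionals defines a bounded operator into `ℓ∞`. -/
theorem exists_clm_lp_infty {f : ℕ → StrongDual ℝ X} {C : ℝ} (hf : ∀ n, ‖f n‖ ≤ C) :
    ∃ T : X →L[ℝ] lp (fun _ : ℕ => ℝ) ∞,
      (∀ x n, T x n = f n x) ∧ ‖T‖ ≤ C ∧ ∀ n, ‖f n‖ ≤ ‖T‖ := by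
  have hC : 0 ≤ C := (norm_nonneg _).trans (hf 0)
  have hle : ∀ x n, ‖f n x‖ ≤ C * ‖x‖ := fun x n => (f n).le_of_opNorm_le (hf n) x
  let L : X →ₗ[ℝ] lp (fun _ : ℕ => ℝ) ∞ :=
    { toFun := fun x => ⟨fun n => f n x, memℓp_infty ⟨C * ‖x‖, by
        rintro _ ⟨n, rfl⟩
        exact hle x n⟩⟩
      map_add' := fun x y => lp.ext (funext fun n => map_add (f n) x y)
      map_smul' := fun c x => lp.ext (funext fun n => map_smul (f n) c x) }
  have hL : ∀ x, ‖L x‖ ≤ C * ‖x‖ := fun x =>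
    lp.norm_le_of_forall_le (by positivity) (hle x)
  refine ⟨L.mkContinuous C hL, fun _ _ => rfl, L.mkContinuous_norm_le hC hL, fun n => ?_⟩
  refine (f n).opNorm_le_bound (norm_nonneg _) fun x => ?_
  exact (lp.norm_apply_le_norm ENNReal.top_ne_zero (L x) n).trans
    ((L.mkContinuous C hL).le_opNorm x)

end Dual

theorem rank_one_perturbation_ell_infty
    (X : Type*) [NormedAddCommGroup X] [NormedSpace ℝ X] [CompleteSpace X]
    (hinf : ¬ FiniteDimensional ℝ X) (hrefl : IsReflexiveSpace X) :
    ∃ S R : X →L[ℝ] lp (fun _ : ℕ => ℝ) ∞,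
      Module.rank ℝ (LinearMap.range (R : X →ₗ[ℝ] lp (fun _ : ℕ => ℝ) ∞)) ≤ 1 ∧
      ‖S‖ = 1 ∧ ‖S‖ < ‖S + R‖ ∧ ¬ NormAttains (S + R) := by
  obtain ⟨h, δ, G, hh, hδ, hinc⟩ := hrefl.exists_norm_increasing hinf
  obtain ⟨e, heG, hen, hnull⟩ := hrefl.exists_weakly_null hinf G
  set M : ℝ := ‖h‖ + δ with hM
  have hMle : ∀ n, M ≤ ‖h + e n‖ := fun n => hinc (e n) (heG n) (hen n)
  have hMpos : 0 < M := by linarith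
  have hpos : ∀ n, 0 < ‖h + e n‖ := fun n => hMpos.trans_le (hMle n)
  let q : ℕ → ℝ := fun n => 1 - 1 / ((n : ℝ) + 2)
  have hq0 : ∀ n, 0 < q n := fun n => by
    have : 1 / ((n : ℝ) + 2) < 1 := by
      rw [div_lt_one (by positivity)]
      linarith [n.cast_nonneg (α := ℝ)]
    exact sub_pos.2 this
  have hq1 : ∀ n, q n < 1 := fun n => sub_lt_self _ (by positivity)
  have hqlim : Tendsto q atTop (𝓝 1) := by
    have h1 : Tendsto (fun n : ℕ => 1 / ((n : ℝ) + 2)) atTop (𝓝 0) :=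
      tendsto_const_nhds.div_atTop
        (tendsto_atTop_add_const_right _ _ tendsto_natCast_atTop_atTop)
    simpa only [sub_zero] using h1.const_sub 1
  let c : ℕ → ℝ := fun n => q n * M / ‖h + e n‖
  have hc0 : ∀ n, 0 < c n := fun n => div_pos (mul_pos (hq0 n) hMpos) (hpos n)
  have hc1 : ∀ n, c n ≤ 1 := fun n => by
    refine (div_le_one (hpos n)).2 (le_trans ?_ (hMle n))
    exact mul_le_of_le_one_left hMpos.le (hq1 n).le
  have hce : ∀ n, ‖c n • e n‖ ≤ 1 / 2 := fun n => by
    rw [norm_smul, hen, Real.norm_of_nonneg (hc0 n).le]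
    linarith [hc1 n]
  have hch : ∀ n, ‖c n • (h + e n)‖ = q n * M := fun n => by
    rw [norm_smul, Real.norm_of_nonneg (hc0 n).le]
    exact div_mul_cancel₀ _ (hpos n).ne'
  have hqM : ∀ n, q n * M < M := fun n => mul_lt_of_lt_one_left hMpos (hq1 n)
  obtain ⟨T, hT, hTle, hTge⟩ := exists_clm_lp_infty hce
  obtain ⟨P, hP, hPle, hPge⟩ := exists_clm_lp_infty (fun n => (hch n).le.trans (hqM n).le)
  have hPnorm : ‖P‖ = M := by
    refine le_antisymm hPle (le_of_tendsto (by simpa using hqlim.mul_const M) ?_)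
    exact Eventually.of_forall fun n => (hch n).ge.trans (hPge n)
  have hTpos : 0 < ‖T‖ := by
    refine lt_of_lt_of_le ?_ (hTge 0)
    rw [norm_smul, hen, Real.norm_of_nonneg (hc0 0).le]
    linarith [hc0 0]
  let y : lp (fun _ : ℕ => ℝ) ∞ := ⟨c, memℓp_infty ⟨1, by
    rintro _ ⟨n, rfl⟩
    simpa [Real.norm_of_nonneg (hc0 n).le] using hc1 n⟩⟩
  have hsum : ‖T‖⁻¹ • T + (‖T‖⁻¹ • h).smulRight y = ‖T‖⁻¹ • P := by
    ext x n
    change ‖T‖⁻¹ * T x n + (‖T‖⁻¹ * h x) * c n = ‖T‖⁻¹ * P x n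
    rw [hT, hP]
    simp only [smul_apply, add_apply, smul_eq_mul]
    ring
  refine ⟨‖T‖⁻¹ • T, (‖T‖⁻¹ • h).smulRight y, ?_, ?_, ?_, ?_⟩
  · refine (Submodule.rank_mono (t := Submodule.span ℝ {y}) ?_).trans
      ((rank_span_le _).trans (Cardinal.mk_singleton _).le)
    rintro _ ⟨x, rfl⟩
    exact Submodule.mem_span_singleton.2 ⟨_, rfl⟩
  · rw [norm_smul, norm_inv, norm_norm, inv_mul_cancel₀ hTpos.ne']
  · rw [hsum, norm_smul, norm_smul, hPnorm]
    refine mul_lt_mul_of_pos_left (by linarith) (norm_pos_iff.2 (inv_ne_zero hTpos.ne'))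
  · rw [hsum]
    rintro ⟨x, hx, hatt⟩
    rw [smul_apply, norm_smul, norm_smul, hPnorm] at hatt
    have hPx : ‖P x‖ = M :=
      mul_left_cancel₀ (norm_ne_zero_iff.2 (inv_ne_zero hTpos.ne')) hatt
    have hcoord : ∀ n, ‖P x n‖ ≤ q n * M := fun n => by
      rw [hP, ← hch n]
      exact (c n • (h + e n)).unit_le_opNorm x hx
    obtain ⟨N, hN⟩ := eventually_atTop.1 ((hnull x).norm.eventually
      (gt_mem_nhds (show ‖(0 : ℝ)‖ < δ / 2 by simpa using hδ)))
    have htail : ∀ n, N ≤ n → ‖P x n‖ ≤ ‖h‖ + δ / 2 := fun n hn => by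
      rw [hP, smul_apply, norm_smul, Real.norm_of_nonneg (hc0 n).le]
      refine (mul_le_of_le_one_left (norm_nonneg _) (hc1 n)).trans ?_
      exact (norm_add_le _ _).trans (add_le_add (h.unit_le_opNorm x hx) (hN n hn).le)
    have hqmono : Monotone q := fun i j hij => by
      dsimp only [q]
      gcongr
    have hbound : ‖P x‖ ≤ max (q N * M) (‖h‖ + δ / 2) := by
      refine lp.norm_le_of_forall_le (le_max_of_le_left (mul_pos (hq0 N) hMpos).le) fun n => ?_
      rcases le_total N n with hn | hn
      · exact (htail n hn).trans (le_max_right _ _)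
      · refine (hcoord n).trans (le_max_of_le_left ?_)
        exact mul_le_mul_of_nonneg_right (hqmono hn) hMpos.le
    have : max (q N * M) (‖h‖ + δ / 2) < M := max_lt (hqM N) (by linarith)
    linarith
end

section
/- Let X be a real Banach space, let x ∈ X with ‖x‖ = 1 be a point at which the norm function y ↦ ‖y‖ is Fréchet differentiable, and let (x_n) be a sequence in the closed unit ball of X such that ‖x − x_n‖ → 2. Then limsup_{n → ∞} ‖x + x_n‖ < 2. -/
open Filter Topology

/-- If the norm is differentiable at `x`, then `‖x + y‖ + ‖x - y‖` is uniformly smaller than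
`2 * ‖x‖ + 2` for `y` in the closed unit ball. -/
theorem exists_norm_add_add_norm_sub_le_of_differentiableAt_norm
    {X : Type*} [NormedAddCommGroup X] [NormedSpace ℝ X] {x : X}
    (hdiff : DifferentiableAt ℝ (fun y : X => ‖y‖) x) :
    ∃ t : ℝ, 0 < t ∧ ∀ y : X, ‖y‖ ≤ 1 → ‖x + y‖ + ‖x - y‖ ≤ 2 * ‖x‖ + 2 - t := by
  obtain ⟨f, hf⟩ := hdiff
  have hsmall := (hasFDerivAt_iff_isLittleO_nhds_zero.1 hf).def (c := 1 / 2) (by norm_num)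
  obtain ⟨δ, hδ, hball⟩ := Metric.eventually_nhds_iff.1 hsmall
  obtain ⟨t, ht, htlt⟩ := exists_between (lt_min hδ one_pos)
  obtain ⟨htδ, ht1⟩ := lt_min_iff.1 htlt
  have bound : ∀ y : X, ‖y‖ ≤ 1 → ‖x + y‖ ≤ ‖x‖ + 1 + t * (f y - 1 / 2) := by
    intro y hy
    have hty : ‖t • y‖ ≤ t := by
      rw [norm_smul, Real.norm_of_nonneg ht.le]
      exact mul_le_of_le_one_right ht.le hy
    have hderiv := hball (y := t • y) (by rw [dist_zero_right]; exact hty.trans_lt htδ)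
    rw [Real.norm_eq_abs, map_smul, smul_eq_mul] at hderiv
    have hupper := (abs_le.1 hderiv).2
    have htri : ‖x + y‖ ≤ ‖x + t • y‖ + (1 - t) * ‖y‖ := by
      calc ‖x + y‖ = ‖(x + t • y) + (1 - t) • y‖ := by congr 1; module
        _ ≤ ‖x + t • y‖ + ‖(1 - t) • y‖ := norm_add_le _ _
        _ = _ := by rw [norm_smul, Real.norm_of_nonneg (sub_nonneg.2 ht1.le)]
    have hrest : (1 - t) * ‖y‖ ≤ 1 - t := mul_le_of_le_one_right (sub_nonneg.2 ht1.le) hy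
    linarith
  refine ⟨t, ht, fun y hy => ?_⟩
  have hpos := bound y hy
  have hneg := bound (-y) (by rwa [norm_neg])
  rw [map_neg, ← sub_eq_add_neg] at hneg
  linarith

theorem limsup_lt_two_of_frechet_diff
    (X : Type*) [NormedAddCommGroup X] [NormedSpace ℝ X]
    (x : X) (hx : ‖x‖ = 1)
    (hdiff : DifferentiableAt ℝ (fun y : X => ‖y‖) x)
    (xs : ℕ → X) (hxs : ∀ n, ‖xs n‖ ≤ 1)
    (hlim : Tendsto (fun n => ‖x - xs n‖) atTop (nhds 2)) :
    Filter.limsup (fun n => ‖x + xs n‖) atTop < 2 := by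
  obtain ⟨t, ht, hsum⟩ := exists_norm_add_add_norm_sub_le_of_differentiableAt_norm hdiff
  have hle : limsup (fun n => ‖x + xs n‖) atTop ≤ 2 - t / 2 := by
    refine limsup_le_of_le (isCoboundedUnder_le_of_le atTop fun n => norm_nonneg _) ?_
    filter_upwards [hlim.eventually (lt_mem_nhds (show 2 - t / 2 < 2 by linarith))] with n hn
    linarith [hsum (xs n) (hxs n)]
  linarith
end

section
/- Let X be an infinite-dimensional reflexive real Banach space. Then there exists a bounded linear operator T : X → ℓ∞ with ‖T‖ > 0 that does not attain its norm. -/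
open Filter Topology
open scoped ENNReal

/-- A separable subset of the dual is separated by a sequence of points in the unit ball. -/
theorem exists_seq_separating_of_isSeparable {X : Type*} [NormedAddCommGroup X] [NormedSpace ℝ X]
    {s : Set (StrongDual ℝ X)} (hs : TopologicalSpace.IsSeparable s) :
    ∃ d : ℕ → X, ∀ g ∈ s, (∀ n, g (d n) = 0) → g = 0 := by
  obtain ⟨c, hc, hsc⟩ := hs
  obtain ⟨e, he⟩ := (hc.insert 0).exists_eq_range (Set.insert_nonempty _ _)
  have hd : ∀ n, ∃ x : X, ‖x‖ ≤ 1 ∧ ‖e n‖ / 2 ≤ ‖e n x‖ := by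
    intro n
    rcases eq_or_ne (e n) 0 with h | h
    · exact ⟨0, by simp, by simp [h]⟩
    · obtain ⟨x, hx, hx'⟩ := (e n).exists_lt_apply_of_lt_opNorm
        (half_lt_self (norm_pos_iff.2 h))
      exact ⟨x, hx.le, hx'.le⟩
  choose d hd1 hd2 using hd
  refine ⟨d, fun g hg h0 => ?_⟩
  have hg' : g ∈ closure (Set.range e) := he ▸ closure_mono (Set.subset_insert _ _) (hsc hg)
  rw [← norm_le_zero_iff]
  refine le_of_forall_pos_le_add fun ε hε => ?_
  obtain ⟨_, ⟨n, rfl⟩, hn⟩ := Metric.mem_closure_iff.1 hg' (ε / 3) (by positivity)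
  rw [dist_eq_norm] at hn
  have h1 : ‖(g - e n) (d n)‖ ≤ ‖g - e n‖ := (g - e n).unit_le_opNorm _ (hd1 n)
  rw [sub_apply, h0 n, zero_sub, norm_neg] at h1
  have h2 := hd2 n
  have h3 : ‖g‖ ≤ ‖g - e n‖ + ‖e n‖ := by simpa using norm_add_le (g - e n) (e n)
  linarith

/-- In a reflexive space, a functional which vanishes wherever all elements of a closed subspace
of the dual vanish belongs to that subspace. -/
theorem IsReflexiveSpace.mem_of_forall_apply_eq_zero {X : Type*} [NormedAddCommGroup X]
    [NormedSpace ℝ X] (hrefl : IsReflexiveSpace X) {Y : Submodule ℝ (StrongDual ℝ X)}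
    (hY : IsClosed (Y : Set (StrongDual ℝ X))) {g : StrongDual ℝ X}
    (h : ∀ x : X, (∀ f ∈ Y, f x = 0) → g x = 0) : g ∈ Y := by
  by_contra hg
  obtain ⟨φ, u, hu, hφg⟩ := geometric_hahn_banach_closed_point Y.convex hY hg
  have hφ : ∀ f ∈ Y, φ f = 0 := by
    intro f hf
    by_contra hne
    have := hu (((u + 1) / φ f) • f) (Y.smul_mem _ hf)
    rw [map_smul, smul_eq_mul, div_mul_cancel₀ _ hne] at this
    linarith
  obtain ⟨x, rfl⟩ := hrefl φ
  have h0 := hu 0 Y.zero_mem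
  have := h x fun f hf => by simpa using hφ f hf
  simp only [NormedSpace.dual_def, map_zero] at hφg h0
  linarith

theorem not_finiteDimensional_strongDual_s5 {X : Type*} [NormedAddCommGroup X] [NormedSpace ℝ X]
    (hinf : ¬ FiniteDimensional ℝ X) : ¬ FiniteDimensional ℝ (StrongDual ℝ X) := by
  intro h
  exact hinf (FiniteDimensional.of_injective
    (NormedSpace.inclusionInDoubleDual ℝ X).toLinearMap
    (NormedSpace.inclusionInDoubleDualLi (E := X) ℝ).injective)

theorem exists_isSeparable_not_finiteDimensional {E : Type*} [NormedAddCommGroup E]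
    [NormedSpace ℝ E] (hinf : ¬ FiniteDimensional ℝ E) :
    ∃ V : Submodule ℝ E, TopologicalSpace.IsSeparable (V : Set E) ∧ ¬ FiniteDimensional ℝ V := by
  let b := Module.Basis.ofVectorSpace ℝ E
  have : Infinite (Module.Basis.ofVectorSpaceIndex ℝ E) := by
    by_contra h
    rw [not_infinite_iff_finite] at h
    exact hinf (Module.Finite.of_basis b)
  let e := Infinite.natEmbedding (Module.Basis.ofVectorSpaceIndex ℝ E)
  refine ⟨Submodule.span ℝ (Set.range (b ∘ e)),
    (Set.countable_range _).isSeparable.span, fun h => ?_⟩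
  have hli : LinearIndependent ℝ (b ∘ e) := b.linearIndependent.comp e e.injective
  have := Module.Finite.finite_basis (Module.Basis.span hli)
  exact not_finite ℕ

theorem exists_norm_eq_one_forall_apply_eq_zero {X : Type*} [NormedAddCommGroup X]
    [NormedSpace ℝ X] {V : Submodule ℝ (StrongDual ℝ X)} (hV : ¬ FiniteDimensional ℝ V)
    (d : ℕ → X) (n : ℕ) : ∃ f ∈ V, ‖f‖ = 1 ∧ ∀ k < n, f (d k) = 0 := by
  let L : V →ₗ[ℝ] (Fin n → ℝ) :=
    { toFun := fun f k => (f : StrongDual ℝ X) (d k)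
      map_add' := fun _ _ => rfl
      map_smul' := fun _ _ => rfl }
  have hL : ¬ Function.Injective L := fun h => hV (FiniteDimensional.of_injective L h)
  rw [injective_iff_map_eq_zero] at hL
  push Not at hL
  obtain ⟨f, hf, hf0⟩ := hL
  have hf0' : (f : StrongDual ℝ X) ≠ 0 := by simpa using hf0
  refine ⟨‖(f : StrongDual ℝ X)‖⁻¹ • (f : StrongDual ℝ X), V.smul_mem _ f.2,
    by simpa using norm_smul_inv_norm (𝕜 := ℝ) hf0', fun k hk => ?_⟩
  have : (f : StrongDual ℝ X) (d k) = 0 := congrFun hf ⟨k, hk⟩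
  simp [this]

/-- The dual of an infinite-dimensional reflexive space contains a weak-star null sequence of
unit vectors. -/
theorem IsReflexiveSpace.exists_norm_eq_one_tendsto_zero {X : Type*} [NormedAddCommGroup X]
    [NormedSpace ℝ X] (hrefl : IsReflexiveSpace X) (hinf : ¬ FiniteDimensional ℝ X) :
    ∃ f : ℕ → StrongDual ℝ X, (∀ n, ‖f n‖ = 1) ∧
      ∀ x, Tendsto (fun n => f n x) atTop (𝓝 0) := by
  obtain ⟨V, hVs, hV⟩ :=
    exists_isSeparable_not_finiteDimensional (not_finiteDimensional_strongDual_s5 hinf)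
  obtain ⟨d, hd⟩ := exists_seq_separating_of_isSeparable hVs.closure
  choose f hfV hf1 hfd using exists_norm_eq_one_forall_apply_eq_zero hV d
  refine ⟨f, hf1, fun x => ?_⟩
  rw [tendsto_iff_ultrafilter]
  intro U hU
  have hK := WeakDual.isCompact_closedBall (𝕜 := ℝ) (E := X) 0 1
  obtain ⟨g, -, hg⟩ := hK.ultrafilter_le_nhds (U.map fun n => StrongDual.toWeakDual (f n)) (by
    rw [Ultrafilter.coe_map, le_principal_iff]
    exact Filter.Eventually.of_forall (f := (U : Filter ℕ)) fun n => by simp [hf1 n])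
  have hlim : ∀ y, Tendsto (fun n => f n y) U (𝓝 (g y)) := fun y =>
    ((WeakDual.eval_continuous y).tendsto g).comp hg
  have hgV : WeakDual.toStrongDual g ∈ V.topologicalClosure := by
    refine hrefl.mem_of_forall_apply_eq_zero V.isClosed_topologicalClosure fun y hy => ?_
    refine tendsto_nhds_unique (hlim y) (tendsto_const_nhds.congr fun n => ?_)
    exact (hy _ (V.le_topologicalClosure (hfV n))).symm
  have hg0 : WeakDual.toStrongDual g = 0 := by
    refine hd _ hgV fun k => ?_
    refine tendsto_nhds_unique (hlim (d k)) (tendsto_const_nhds.congr' ?_)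
    filter_upwards [hU (Ioi_mem_atTop k)] with n hn
    exact (hfd n k hn).symm
  have : g x = 0 := congrArg (fun h : StrongDual ℝ X => h x) hg0
  exact this ▸ hlim x

/-- The operator into `ℓ∞` whose coordinates are a given sequence of functionals in the unit
ball. -/
noncomputable def ellInftyOfFunctionals {X : Type*} [NormedAddCommGroup X] [NormedSpace ℝ X]
    (f : ℕ → StrongDual ℝ X) (hf : ∀ n, ‖f n‖ ≤ 1) : X →L[ℝ] lp (fun _ : ℕ => ℝ) ∞ :=
  LinearMap.mkContinuous
    { toFun := fun x => ⟨fun n => f n x, memℓp_infty ⟨‖x‖, by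
        rintro _ ⟨n, rfl⟩
        simpa using (f n).le_of_opNorm_le (hf n) x⟩⟩
      map_add' := fun x y => Subtype.ext (funext fun n => (f n).map_add x y)
      map_smul' := fun c x => by ext n; simp }
    1 fun x => by
      rw [one_mul]
      refine lp.norm_le_of_forall_le (norm_nonneg x) fun n => ?_
      simpa using (f n).le_of_opNorm_le (hf n) x

theorem ellInftyOfFunctionals_apply {X : Type*} [NormedAddCommGroup X] [NormedSpace ℝ X]
    (f : ℕ → StrongDual ℝ X) (hf : ∀ n, ‖f n‖ ≤ 1) (x : X) (n : ℕ) :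
    ellInftyOfFunctionals f hf x n = f n x := rfl

theorem norm_le_norm_ellInftyOfFunctionals {X : Type*} [NormedAddCommGroup X] [NormedSpace ℝ X]
    (f : ℕ → StrongDual ℝ X) (hf : ∀ n, ‖f n‖ ≤ 1) (n : ℕ) :
    ‖f n‖ ≤ ‖ellInftyOfFunctionals f hf‖ := by
  refine (f n).opNorm_le_bound (norm_nonneg _) fun x => ?_
  rw [← ellInftyOfFunctionals_apply f hf]
  exact (lp.norm_apply_le_norm ENNReal.top_ne_zero _ n).trans
    ((ellInftyOfFunctionals f hf).le_opNorm x)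

theorem exists_non_norm_attaining_into_ell_infty
    (X : Type*) [NormedAddCommGroup X] [NormedSpace ℝ X] [CompleteSpace X]
    (hinf : ¬ FiniteDimensional ℝ X) (hrefl : IsReflexiveSpace X) :
    ∃ T : X →L[ℝ] lp (fun _ : ℕ => ℝ) ∞, 0 < ‖T‖ ∧ ¬ NormAttains T := by
  obtain ⟨f, hf1, hf0⟩ := hrefl.exists_norm_eq_one_tendsto_zero hinf
  let a : ℕ → ℝ := fun n => 1 - 1 / ((n : ℝ) + 2)
  have hmono : StrictMono a := fun m n hmn => by
    have : (m : ℝ) < n := by exact_mod_cast hmn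
    have : 1 / ((n : ℝ) + 2) < 1 / ((m : ℝ) + 2) := by gcongr
    simp only [a]
    linarith
  have ha0 : a 0 = 1 / 2 := by norm_num [a]
  have ha : ∀ n, 1 / 2 ≤ a n := fun n => ha0 ▸ hmono.monotone n.zero_le
  have hle : ∀ n, a n ≤ 1 := fun n => by
    have : 0 ≤ 1 / ((n : ℝ) + 2) := by positivity
    simp only [a]
    linarith
  have hnorm : ∀ n, ‖a n • f n‖ = a n := fun n => by
    rw [norm_smul, hf1, mul_one, Real.norm_of_nonneg (by linarith [ha n])]
  have hball : ∀ n, ‖a n • f n‖ ≤ 1 := fun n => (hnorm n).trans_le (hle n)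
  have hT : ∀ n, a n ≤ ‖ellInftyOfFunctionals (fun n => a n • f n) hball‖ := fun n =>
    (hnorm n).symm.trans_le (norm_le_norm_ellInftyOfFunctionals _ hball n)
  refine ⟨ellInftyOfFunctionals (fun n => a n • f n) hball, one_half_pos.trans_le ((ha 0).trans (hT 0)), ?_⟩
  rintro ⟨x, hx, hxT⟩
  obtain ⟨N, hN⟩ := Metric.tendsto_atTop.1 (hf0 x) (1 / 2) (by norm_num)
  have hbound : ‖ellInftyOfFunctionals (fun n => a n • f n) hball x‖ ≤ a N := by
    refine lp.norm_le_of_forall_le (by linarith [ha N]) fun n => ?_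
    rw [ellInftyOfFunctionals_apply]
    rcases le_total N n with h | h
    · have h1 := hN n h
      rw [dist_zero_right] at h1
      rw [smul_apply, norm_smul, Real.norm_of_nonneg (by linarith [ha n])]
      have := mul_le_mul (hle n) h1.le (norm_nonneg _) zero_le_one
      linarith [ha N]
    · exact ((a n • f n).unit_le_opNorm x hx).trans ((hnorm n).trans_le (hmono.monotone h))
  linarith [hT (N + 1), hmono N.lt_succ_self]
end

section
/- Let X be an infinite-dimensional real Banach space. Then there exist a real Banach space Z and a continuous linear equivalence (a bounded linear isomorphism with bounded inverse) from X onto Z such that the pair (Z, Z) fails the compact perturbation property. -/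
open Filter Topology

theorem exists_norm_eq_one_forall_mem_eq_zero {Y : Type*} [NormedAddCommGroup Y] [NormedSpace ℝ Y]
    (hinf : ¬ FiniteDimensional ℝ Y) {s : Set Y} (hs : s.Finite) :
    ∃ f : StrongDual ℝ Y, ‖f‖ = 1 ∧ ∀ y ∈ s, f y = 0 := by
  set F := Submodule.span ℝ s
  have hfd : FiniteDimensional ℝ F := FiniteDimensional.span_of_finite ℝ hs
  have hclosed : IsClosed (F : Set Y) := F.closed_of_finiteDimensional
  have hne : F ≠ ⊤ := by
    intro h
    rw [h] at hfd
    exact hinf (Module.Finite.equiv Submodule.topEquiv)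
  obtain ⟨x, hx⟩ : ∃ x, x ∉ F := by
    by_contra! h
    exact hne (eq_top_iff.2 fun x _ => h x)
  have hx' : ‖(Submodule.Quotient.mk x : Y ⧸ F)‖ ≠ 0 := by
    rwa [norm_ne_zero_iff, Ne, Submodule.Quotient.mk_eq_zero]
  obtain ⟨g, -, hg⟩ := exists_dual_vector ℝ (Submodule.Quotient.mk x : Y ⧸ F) hx'
  set f : StrongDual ℝ Y := g.comp F.mkQL with hf
  have hfx : f x ≠ 0 := by
    have : f x = ‖(Submodule.Quotient.mk x : Y ⧸ F)‖ := hg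
    rwa [this]
  have hf0 : ‖f‖ ≠ 0 := by
    rw [norm_ne_zero_iff]
    intro h
    simp [h] at hfx
  refine ⟨‖f‖⁻¹ • f, by simp [norm_smul, hf0], fun y hy => ?_⟩
  have : (Submodule.Quotient.mk y : Y ⧸ F) = 0 :=
    (Submodule.Quotient.mk_eq_zero F).2 (Submodule.subset_span hy)
  simp [hf, this]

theorem exists_seq_almost_norming_triangular {Y : Type*} [NormedAddCommGroup Y] [NormedSpace ℝ Y]
    (hinf : ¬ FiniteDimensional ℝ Y) :
    ∃ (f : ℕ → StrongDual ℝ Y) (y : ℕ → Y), (∀ n, ‖f n‖ ≤ 1) ∧ (∀ n, ‖y n‖ ≤ 1) ∧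
      (∀ n : ℕ, 1 - 1 / ((n : ℝ) + 1) < f n (y n)) ∧ ∀ m n, m < n → f n (y m) = 0 := by
  obtain ⟨u, hu, hur⟩ := exists_seq_of_forall_finset_exists
    (α := ℕ × StrongDual ℝ Y × Y)
    (fun p => ‖p.2.1‖ ≤ 1 ∧ ‖p.2.2‖ ≤ 1 ∧ 1 - 1 / ((p.1 : ℝ) + 1) < p.2.1 p.2.2)
    (fun p q => p.1 < q.1 ∧ q.2.1 p.2.2 = 0) (by
      intro s _
      obtain ⟨f, hf, hfs⟩ := exists_norm_eq_one_forall_mem_eq_zero hinf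
        (s.finite_toSet.image fun p => p.2.2)
      set k := s.sup (fun p => p.1) + 1
      have hk : 1 - 1 / ((k : ℝ) + 1) < ‖f‖ := by
        rw [hf]
        have : 0 < 1 / ((k : ℝ) + 1) := by positivity
        linarith
      obtain ⟨x, hx, hfx⟩ := f.exists_lt_apply_of_lt_opNorm hk
      obtain ⟨y, hy, hfy⟩ : ∃ y, ‖y‖ < 1 ∧ 1 - 1 / ((k : ℝ) + 1) < f y := by
        rcases le_total 0 (f x) with h | h
        · exact ⟨x, hx, by rwa [Real.norm_of_nonneg h] at hfx⟩
        · exact ⟨-x, by rwa [norm_neg], by rwa [Real.norm_of_nonpos h, ← map_neg] at hfx⟩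
      refine ⟨(k, f, y), ⟨hf.le, hy.le, hfy⟩, fun p hp => ⟨?_, ?_⟩⟩
      · exact Nat.lt_succ_of_le (Finset.le_sup (f := fun p : ℕ × StrongDual ℝ Y × Y => p.1) hp)
      · exact hfs _ ⟨p, hp, rfl⟩)
  have hmono : StrictMono fun n => (u n).1 := fun m n h => (hur m n h).1
  refine ⟨fun n => (u n).2.1, fun n => (u n).2.2, fun n => (hu n).1, fun n => (hu n).2.1,
    fun n => lt_of_le_of_lt ?_ (hu n).2.2, fun m n h => (hur m n h).2⟩
  have : (n : ℝ) ≤ (u n).1 := by exact_mod_cast hmono.le_apply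
  gcongr

/-- Every infinite-dimensional space embeds isomorphically, via `D`, into a normed space in such a
way that some bounded operator `G` to `ℓ∞` does not attain its norm for the induced norm. -/
theorem exists_embedding_not_norm_attaining {Y : Type} [NormedAddCommGroup Y] [NormedSpace ℝ Y]
    (hinf : ¬ FiniteDimensional ℝ Y) :
    ∃ (E : Type) (_ : NormedAddCommGroup E) (_ : NormedSpace ℝ E) (D : Y →L[ℝ] E)
      (G : Y →L[ℝ] BoundedContinuousFunction ℕ ℝ),
      (∀ y, ‖y‖ ≤ ‖D y‖) ∧ (∀ y, y ≠ 0 → ‖G y‖ < ‖D y‖) ∧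
      ∀ r < 1, ∃ y, ‖D y‖ ≤ 1 ∧ ∃ n, r < G y n := by
  obtain ⟨f, y, hf, hy, hfy, hfym⟩ := exists_seq_almost_norming_triangular hinf
  set W := (Submodule.span ℝ (Set.range y)).topologicalClosure
  have hWc : IsClosed (W : Set Y) := Submodule.isClosed_topologicalClosure _
  have hfle : ∀ n x, |f n x| ≤ ‖x‖ := fun n x => by
    simpa using (f n).le_of_opNorm_le (hf n) x
  have hspan : ∀ w ∈ Submodule.span ℝ (Set.range y), ∀ᶠ n in atTop, f n w = 0 := by
    intro w hw
    induction hw using Submodule.span_induction with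
    | mem x hx =>
      obtain ⟨m, rfl⟩ := hx
      filter_upwards [eventually_gt_atTop m] with n hn using hfym m n hn
    | zero => simp
    | add a b _ _ ha hb => filter_upwards [ha, hb] with n h1 h2 using by simp [h1, h2]
    | smul c a _ ha => filter_upwards [ha] with n h1 using by simp [h1]
  have hlim : ∀ x, ∀ ε > 0, ∀ᶠ n in atTop, |f n x| ≤ ‖(Submodule.Quotient.mk x : Y ⧸ W)‖ + ε := by
    intro x ε hε
    obtain ⟨v, hv, hvn⟩ := Submodule.Quotient.norm_mk_lt
      (Submodule.Quotient.mk x : Y ⧸ W) (half_pos hε)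
    have hxv : x - v ∈ W := (Submodule.Quotient.eq W).1 hv.symm
    obtain ⟨w, hw, hwd⟩ := Metric.mem_closure_iff.1 hxv (ε / 2) (half_pos hε)
    rw [dist_eq_norm] at hwd
    filter_upwards [hspan w hw] with n hn
    have : f n x = f n v + f n (x - v - w) := by simp [hn]
    rw [this]
    have h1 := hfle n v
    have h2 := hfle n (x - v - w)
    have h3 := abs_add_le (f n v) (f n (x - v - w))
    linarith
  set c : ℕ → ℝ := fun n => 1 - 1 / ((n : ℝ) + 1) with hc
  have hc0 : ∀ n, 0 ≤ c n := fun n => by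
    have : 1 / ((n : ℝ) + 1) ≤ 1 := by
      rw [div_le_one (by positivity)]; linarith [n.cast_nonneg (α := ℝ)]
    simp only [hc]; linarith
  have hc1 : ∀ n, c n < 1 := fun n => by
    have : 0 < 1 / ((n : ℝ) + 1) := by positivity
    simp only [hc]; linarith
  have hcf : ∀ n x, |c n * f n x| ≤ ‖x‖ := fun n x => by
    rw [abs_mul, abs_of_nonneg (hc0 n)]
    nlinarith [hfle n x, hc1 n, hc0 n, abs_nonneg (f n x)]
  let G : Y →L[ℝ] BoundedContinuousFunction ℕ ℝ := LinearMap.mkContinuous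
    { toFun := fun x => BoundedContinuousFunction.ofNormedAddCommGroupDiscrete
        (fun n => c n * f n x) ‖x‖ (fun n => hcf n x)
      map_add' := fun a b => by ext n; simp [mul_add]
      map_smul' := fun a b => by ext n; simp; ring } 1 (fun x => by
        rw [one_mul]
        exact (BoundedContinuousFunction.norm_le (norm_nonneg x)).2 (fun n => hcf n x))
  have hG : ∀ x n, G x n = c n * f n x := fun x n => rfl
  let D : Y →L[ℝ] WithLp 1 (Y × (Y ⧸ W)) :=
    (WithLp.prodContinuousLinearEquiv 1 ℝ Y (Y ⧸ W)).symm.toContinuousLinearMap.comp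
      ((ContinuousLinearMap.id ℝ Y).prod W.mkQL)
  have hD : ∀ x, ‖D x‖ = ‖x‖ + ‖(Submodule.Quotient.mk x : Y ⧸ W)‖ := fun x => by
    rw [WithLp.prod_norm_eq_of_L1]
    rfl
  refine ⟨WithLp 1 (Y × (Y ⧸ W)), inferInstance, inferInstance, D, G, fun x => ?_, fun x hx => ?_,
    fun r hr => ?_⟩
  · rw [hD]
    linarith [norm_nonneg (Submodule.Quotient.mk x : Y ⧸ W)]
  · have hx' := norm_pos_iff.2 hx
    rw [hD]
    set q := ‖(Submodule.Quotient.mk x : Y ⧸ W)‖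
    have hq0 : 0 ≤ q := norm_nonneg _
    obtain ⟨N, hN⟩ := eventually_atTop.1 (hlim x (‖x‖ / 2) (half_pos hx'))
    have hcN : c N * (‖x‖ + q) < ‖x‖ + q := by nlinarith [hc1 N]
    refine lt_of_le_of_lt ((BoundedContinuousFunction.norm_le
      (C := max (q + ‖x‖ / 2) (c N * (‖x‖ + q))) (by positivity)).2 fun n => ?_)
      (max_lt (by linarith) hcN)
    rw [hG, Real.norm_eq_abs, abs_mul, abs_of_nonneg (hc0 n)]
    rcases le_total N n with h | h
    · refine le_max_of_le_left (le_trans ?_ (hN n h))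
      nlinarith [hc1 n, abs_nonneg (f n x)]
    · refine le_max_of_le_right ?_
      have h1 : c n ≤ c N := by
        simp only [hc]
        gcongr
      exact mul_le_mul h1 (by linarith [hfle n x]) (abs_nonneg _) (hc0 N)
  · have hc' : Tendsto (fun n => c n * c n) atTop (𝓝 1) := by
      have : Tendsto c atTop (𝓝 (1 - 0)) :=
        tendsto_const_nhds.sub tendsto_one_div_add_atTop_nhds_zero_nat
      simpa using this.mul this
    obtain ⟨n, hn⟩ := (hc'.eventually (lt_mem_nhds hr)).exists
    refine ⟨y n, ?_, n, ?_⟩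
    · have : (Submodule.Quotient.mk (y n) : Y ⧸ W) = 0 :=
        (Submodule.Quotient.mk_eq_zero W).2
          (Submodule.le_topologicalClosure _ (Submodule.subset_span ⟨n, rfl⟩))
      rw [hD, this, norm_zero, add_zero]
      exact hy n
    · rw [hG]
      exact hn.trans_le (mul_le_mul_of_nonneg_left (hfy n).le (hc0 n))

/-- Failure of the compact perturbation property transferred to the range of an isomorphic
embedding `Φ`. -/
theorem exists_equiv_not_CPP_of_embedding {X E : Type} [NormedAddCommGroup X] [NormedSpace ℝ X]
    [CompleteSpace X] [NormedAddCommGroup E] [NormedSpace ℝ E] (Φ : X →L[ℝ] E)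
    (hΦ : ∀ x, ‖x‖ ≤ ‖Φ x‖) (T K : X →L[ℝ] X) (hK : IsCompactOperator K)
    (hT : ∀ x, ‖Φ (T x)‖ ≤ ‖Φ x‖) (hlt : ∀ x, x ≠ 0 → ‖Φ (T x + K x)‖ < 2 * ‖Φ x‖)
    (hsup : ∀ r < 2, ∃ x, ‖Φ x‖ ≤ 1 ∧ r < ‖Φ (T x + K x)‖) :
    ∃ Z : BanachSpace, ∃ _ : X ≃L[ℝ] Z.carrier, ¬ CPP Z.carrier Z.carrier := by
  have hanti : AntilipschitzWith 1 Φ := Φ.antilipschitz_of_bound fun x => by simpa using hΦ x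
  let e : X ≃L[ℝ] Φ.range :=
    (LinearEquiv.ofInjective (Φ : X →ₗ[ℝ] E) hanti.injective).toContinuousLinearEquivOfBounds
      ‖Φ‖ 1 Φ.le_opNorm fun z => by
        obtain ⟨x, rfl⟩ := (LinearEquiv.ofInjective (Φ : X →ₗ[ℝ] E) hanti.injective).surjective z
        simpa using hΦ x
  have he : ∀ x, ‖e x‖ = ‖Φ x‖ := fun x => rfl
  have hcomp : CompleteSpace Φ.range :=
    (hanti.isComplete_range Φ.uniformContinuous).completeSpace_coe
  refine ⟨⟨Φ.range⟩, e, fun h => ?_⟩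
  let T' : Φ.range →L[ℝ] Φ.range :=
    e.toContinuousLinearMap.comp (T.comp e.symm.toContinuousLinearMap)
  let K' : Φ.range →L[ℝ] Φ.range :=
    e.toContinuousLinearMap.comp (K.comp e.symm.toContinuousLinearMap)
  have hK' : IsCompactOperator K' := (hK.comp_clm e.symm.toContinuousLinearMap).clm_comp
    e.toContinuousLinearMap
  have hTK : ∀ x, ‖(T' + K') (e x)‖ = ‖Φ (T x + K x)‖ := fun x => by
    rw [← he]
    simp [T', K']
  have hT' : ‖T'‖ ≤ 1 := T'.opNorm_le_bound zero_le_one fun z => by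
    obtain ⟨x, rfl⟩ := e.surjective z
    simpa [T', he] using hT x
  have hTK2 : ‖T' + K'‖ = 2 := by
    refine le_antisymm ((T' + K').opNorm_le_bound zero_le_two fun z => ?_) ?_
    · obtain ⟨x, rfl⟩ := e.surjective z
      rw [hTK, he]
      rcases eq_or_ne x 0 with rfl | hx
      · simp
      · exact (hlt x hx).le
    · refine le_of_forall_lt fun r hr => ?_
      obtain ⟨x, hx, hrx⟩ := hsup r hr
      rw [← hTK] at hrx
      refine hrx.trans_le (((T' + K').le_opNorm _).trans ?_)
      exact mul_le_of_le_one_right (norm_nonneg _) (by rwa [he])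
  obtain ⟨z, hz, hz'⟩ := h T' K' hK' (by rw [hTK2]; linarith)
  obtain ⟨x, rfl⟩ := e.surjective z
  rw [hTK2, hTK] at hz'
  change ‖e x‖ ≤ 1 at hz
  rw [he] at hz
  rcases eq_or_ne x 0 with rfl | hx
  · simp at hz'
  · linarith [hlt x hx]

theorem exists_equiv_real_prod {X : Type} [NormedAddCommGroup X] [NormedSpace ℝ X]
    [CompleteSpace X] (hinf : ¬ FiniteDimensional ℝ X) :
    ∃ (Y : Type) (_ : NormedAddCommGroup Y) (_ : NormedSpace ℝ Y) (_ : CompleteSpace Y)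
      (_ : X ≃L[ℝ] ℝ × Y), ¬ FiniteDimensional ℝ Y := by
  obtain ⟨f, hf, -⟩ := exists_norm_eq_one_forall_mem_eq_zero hinf Set.finite_empty
  obtain ⟨x, hx⟩ : ∃ x, f x ≠ 0 := by
    by_contra! h
    have : f = 0 := ContinuousLinearMap.ext h
    simp [this] at hf
  let e : X ≃L[ℝ] ℝ × f.ker := ContinuousLinearEquiv.equivOfRightInverse f
    (ContinuousLinearMap.toSpanSingleton ℝ ((f x)⁻¹ • x)) fun t => by simp [hx]
  refine ⟨f.ker, inferInstance, inferInstance, f.isClosed_ker.completeSpace_coe, e, fun h => ?_⟩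
  exact hinf (Module.Finite.equiv e.symm.toLinearEquiv)

theorem renorming_failing_CPP
    (X : Type) [NormedAddCommGroup X] [NormedSpace ℝ X] [CompleteSpace X]
    (hinf : ¬ FiniteDimensional ℝ X) :
    ∃ Z : BanachSpace, ∃ _ : X ≃L[ℝ] Z.carrier, ¬ CPP Z.carrier Z.carrier := by
  obtain ⟨Y₁, _, _, _, e₁, hinf₁⟩ := exists_equiv_real_prod hinf
  obtain ⟨Y, _, _, _, e₂, hinf₂⟩ := exists_equiv_real_prod hinf₁
  let e : X ≃L[ℝ] ℝ × ℝ × Y := e₁.trans ((ContinuousLinearEquiv.refl ℝ ℝ).prodCongr e₂)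
  obtain ⟨E, _, _, D, G, hD, hGD, hG⟩ := exists_embedding_not_norm_attaining hinf₂
  suffices ∃ Z : BanachSpace, ∃ _ : (ℝ × ℝ × Y) ≃L[ℝ] Z.carrier, ¬ CPP Z.carrier Z.carrier by
    obtain ⟨Z, e', hZ⟩ := this
    exact ⟨Z, e.trans e', hZ⟩
  let a : ℝ × ℝ × Y →L[ℝ] ℝ := ContinuousLinearMap.fst ℝ ℝ (ℝ × Y)
  let b : ℝ × ℝ × Y →L[ℝ] ℝ :=
    (ContinuousLinearMap.fst ℝ ℝ Y).comp (ContinuousLinearMap.snd ℝ ℝ (ℝ × Y))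
  let y : ℝ × ℝ × Y →L[ℝ] Y :=
    (ContinuousLinearMap.snd ℝ ℝ Y).comp (ContinuousLinearMap.snd ℝ ℝ (ℝ × Y))
  let one : BoundedContinuousFunction ℕ ℝ := BoundedContinuousFunction.const ℕ 1
  let Φ : ℝ × ℝ × Y →L[ℝ] ℝ × ℝ × E × BoundedContinuousFunction ℕ ℝ :=
    a.prod (b.prod ((D.comp y).prod (G.comp y + b.smulRight one)))
  have hone : ‖one‖ = 1 := by simp [one]
  have hΦ : ∀ s t v, ‖Φ (s, t, v)‖ = max |s| (max |t| (max ‖D v‖ ‖G v + t • one‖)) :=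
    fun s t v => rfl
  have hGD' : ∀ v, ‖G v‖ ≤ ‖D v‖ := fun v => by
    rcases eq_or_ne v 0 with rfl | hv
    · simp
    · exact (hGD v hv).le
  let T : ℝ × ℝ × Y →L[ℝ] ℝ × ℝ × Y :=
    (ContinuousLinearMap.inr ℝ ℝ (ℝ × Y)).comp ((ContinuousLinearMap.inr ℝ ℝ Y).comp y)
  let K : ℝ × ℝ × Y →L[ℝ] ℝ × ℝ × Y :=
    (ContinuousLinearMap.toSpanSingleton ℝ ((0, 1, 0) : ℝ × ℝ × Y)).comp a
  have hTK : ∀ s t v, T (s, t, v) + K (s, t, v) = (0, s, v) := fun s t v => by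
    change ((0 : ℝ), (0 : ℝ), v) + s • ((0 : ℝ), (1 : ℝ), (0 : Y)) = _
    simp
  refine exists_equiv_not_CPP_of_embedding Φ ?_ T K ?_ ?_ ?_ ?_
  · rintro ⟨s, t, v⟩
    rw [hΦ]
    change max |s| (max |t| ‖v‖) ≤ _
    gcongr
    exact le_max_of_le_left (hD v)
  · exact IsCompactOperator.comp_clm
      (isCompactOperator_of_locallyCompactSpace_rng
        (ContinuousLinearMap.toSpanSingleton ℝ ((0, 1, 0) : ℝ × ℝ × Y))) a
  · rintro ⟨s, t, v⟩
    change ‖Φ (0, 0, v)‖ ≤ _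
    rw [hΦ, hΦ]
    simp [hGD' v]
  · rintro ⟨s, t, v⟩ hx
    rw [hTK]
    have hpos : 0 < ‖Φ (s, t, v)‖ := by
      rw [hΦ]
      by_contra! h
      simp only [max_le_iff] at h
      apply hx
      have h1 := abs_nonpos_iff.1 h.1
      have h2 := abs_nonpos_iff.1 h.2.1
      have h3 := norm_le_zero_iff.1 ((hD v).trans h.2.2.1)
      simp [h1, h2, h3]
    have hs : |s| ≤ ‖Φ (s, t, v)‖ := by rw [hΦ]; simp
    have hv : ‖D v‖ ≤ ‖Φ (s, t, v)‖ := by rw [hΦ]; simp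
    have hsum : ‖G v + s • one‖ ≤ ‖G v‖ + |s| := by
      simpa [norm_smul, hone] using norm_add_le (G v) (s • one)
    have hlt : ‖G v‖ < ‖Φ (s, t, v)‖ := by
      rcases eq_or_ne v 0 with rfl | hv'
      · simpa using hpos
      · exact (hGD v hv').trans_le hv
    rw [hΦ 0 s v]
    refine max_lt ?_ (max_lt ?_ (max_lt ?_ ?_)) <;> first | (rw [abs_zero]; linarith) | linarith
  · intro r hr
    obtain ⟨v, hv, n, hn⟩ := hG (r - 1) (by linarith)
    refine ⟨(1, 0, v), ?_, ?_⟩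
    · rw [hΦ]
      simp [hv, (hGD' v).trans hv]
    · rw [hTK, hΦ]
      refine lt_of_lt_of_le ?_ ((le_max_right _ _).trans ((le_max_right _ _).trans
        (le_max_right _ _)))
      refine lt_of_lt_of_le ?_ ((G v + (1 : ℝ) • one).apply_le_norm n)
      simp [one]
      linarith
end

section
/- Let X and Y be real Banach spaces and suppose there exists a bounded linear operator T : X → Y that does not attain its norm. Let p, q be extended nonnegative reals with 1 ≤ q < p ≤ ∞ and q ≠ ∞. Then the pair (X ⊕_p ℝ, Y ⊕_q ℝ) fails the compact perturbation property; indeed, the operator T̃ : X ⊕_p ℝ → Y ⊕_q ℝ given by T̃(x, a) = (T x, 0) and the rank-one operator R(x, a) = (0, a) satisfy ‖T̃ + R‖ > ‖T̃‖ while T̃ + R does not attain its norm. -/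
open Filter Topology
open scoped ENNReal

theorem Real.exists_lt_mul_rpow_add_mul_one_sub_rpow {c d s : ℝ} (hc : 0 < c) (hd : 0 < d)
    (hs : s < 1) : ∃ ε : ℝ, 0 < ε ∧ ε < 1 ∧ d < c * ε ^ s + d * (1 - ε) ^ s := by
  have hlim : Tendsto (fun ε : ℝ => d * ε ^ (1 - s)) (𝓝[>] 0) (𝓝 0) := by
    have h : ContinuousAt (fun ε : ℝ => d * ε ^ (1 - s)) 0 :=
      continuousAt_const.mul (Real.continuousAt_rpow_const _ _ (Or.inr (by linarith)))
    have h' := h.tendsto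
    rw [Real.zero_rpow (by linarith), mul_zero] at h'
    exact h'.mono_left nhdsWithin_le_nhds
  obtain ⟨ε, hε, hε0, hε1⟩ :=
    ((hlim.eventually (gt_mem_nhds hc)).and (Ioo_mem_nhdsGT one_pos)).exists
  refine ⟨ε, hε0, hε1, ?_⟩
  have hsplit : ε ^ (1 - s) * ε ^ s = ε := by
    rw [← Real.rpow_add hε0]; simp
  have hpos : 0 < ε ^ s := Real.rpow_pos_of_pos hε0 s
  have hsub : 1 - ε ≤ (1 - ε) ^ s :=
    Real.self_le_rpow_of_le_one (by linarith) (by linarith) hs.le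
  have h1 : d * ε < c * ε ^ s := by
    calc d * ε = d * ε ^ (1 - s) * ε ^ s := by rw [mul_assoc, hsplit]
      _ < c * ε ^ s := mul_lt_mul_of_pos_right hε hpos
  have h2 := mul_le_mul_of_nonneg_left hsub hd.le
  linarith

namespace WithLp

variable {E F E' F' : Type*} [NormedAddCommGroup E] [NormedAddCommGroup F]
  [NormedAddCommGroup E'] [NormedAddCommGroup F']

theorem prod_norm_rpow_eq_add {q : ℝ≥0∞} (hq : 0 < q.toReal)
    (z : WithLp q (E × F)) :
    ‖z‖ ^ q.toReal = ‖z.fst‖ ^ q.toReal + ‖z.snd‖ ^ q.toReal := by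
  rw [prod_norm_eq_add hq, ← Real.rpow_mul (by positivity), one_div, inv_mul_cancel₀ hq.ne',
    Real.rpow_one]

theorem prod_norm_le_prod_norm {p : ℝ≥0∞} (hp : p ≠ 0)
    {z : WithLp p (E × F)} {w : WithLp p (E' × F')} (h₁ : ‖z.fst‖ ≤ ‖w.fst‖)
    (h₂ : ‖z.snd‖ ≤ ‖w.snd‖) : ‖z‖ ≤ ‖w‖ := by
  rcases eq_or_ne p ∞ with rfl | hp'
  · rw [prod_norm_eq_sup, prod_norm_eq_sup]
    exact sup_le_sup h₁ h₂
  · have hr := ENNReal.toReal_pos hp hp'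
    rw [prod_norm_eq_add hr, prod_norm_eq_add hr]
    gcongr

theorem prod_norm_swap {p : ℝ≥0∞} (hp : p ≠ 0) (x : E) (y : F) :
    ‖toLp p (y, x)‖ = ‖toLp p (x, y)‖ := by
  rcases eq_or_ne p ∞ with rfl | hp'
  · simp only [prod_norm_eq_sup, toLp_fst, toLp_snd, sup_comm]
  · have hr := ENNReal.toReal_pos hp hp'
    simp only [prod_norm_eq_add hr, toLp_fst, toLp_snd, add_comm]

/-- For `q < p`, the second unit vector does not maximise `c u ^ q + d a ^ q` on the unit ball
of the two-dimensional `ℓ^p`. -/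
theorem exists_norm_le_one_lt_mul_rpow_add_mul_rpow {p q : ℝ≥0∞} (hq : q ≠ 0) (hqp : q < p)
    {c d : ℝ} (hc : 0 < c) (hd : 0 < d) :
    ∃ u a : ℝ, 0 < u ∧ 0 < a ∧ ‖toLp p (u, a)‖ ≤ 1 ∧
      d < c * u ^ q.toReal + d * a ^ q.toReal := by
  rcases eq_or_ne p ∞ with rfl | hp
  · refine ⟨1, 1, one_pos, one_pos, ?_, ?_⟩
    · simp
    · simpa using hc
  · have hr : 0 < q.toReal := ENNReal.toReal_pos hq hqp.ne_top
    have hrp : q.toReal < p.toReal := (ENNReal.toReal_lt_toReal hqp.ne_top hp).2 hqp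
    have hp0 : 0 < p.toReal := hr.trans hrp
    obtain ⟨ε, hε0, hε1, hε⟩ := Real.exists_lt_mul_rpow_add_mul_one_sub_rpow hc hd
      ((div_lt_one hp0).2 hrp)
    have hε1' : 0 < 1 - ε := by linarith
    refine ⟨ε ^ (1 / p.toReal), (1 - ε) ^ (1 / p.toReal), Real.rpow_pos_of_pos hε0 _,
      Real.rpow_pos_of_pos hε1' _, ?_, ?_⟩
    · rw [prod_norm_eq_add hp0]
      simp only [toLp_fst, toLp_snd, Real.norm_eq_abs]
      rw [abs_of_pos (Real.rpow_pos_of_pos hε0 _), abs_of_pos (Real.rpow_pos_of_pos hε1' _),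
        ← Real.rpow_mul hε0.le, ← Real.rpow_mul hε1'.le, one_div_mul_cancel hp0.ne']
      simp
    · rwa [← Real.rpow_mul hε0.le, ← Real.rpow_mul hε1'.le, one_div_mul_eq_div]

end WithLp

section Extension

variable {X Y : Type*} [NormedAddCommGroup X] [NormedSpace ℝ X]
  [NormedAddCommGroup Y] [NormedSpace ℝ Y]

theorem norm_apply_lt_of_not_normAttains {T : X →L[ℝ] Y} (hT : ¬ NormAttains T) {x : X}
    (hx : x ≠ 0) : ‖T x‖ < ‖T‖ * ‖x‖ := by
  refine lt_of_le_of_ne (T.le_opNorm x) fun h => hT ⟨‖x‖⁻¹ • x, ?_, ?_⟩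
  · rw [norm_smul, norm_inv, norm_norm, inv_mul_cancel₀ (norm_ne_zero_iff.2 hx)]
  · have hx' : ‖x‖ ≠ 0 := norm_ne_zero_iff.2 hx
    rw [map_smul, norm_smul, h, norm_inv, norm_norm]
    field_simp

theorem norm_pos_of_not_normAttains {T : X →L[ℝ] Y} (hT : ¬ NormAttains T) : 0 < ‖T‖ := by
  refine (norm_nonneg T).lt_of_ne fun h => hT ⟨0, by simp, by simpa using h⟩

variable (p q : ℝ≥0∞)

/-- The operator `(x, a) ↦ (T x, 0)` from `X ⊕_p ℝ` to `Y ⊕_q ℝ`. -/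
noncomputable def extendByZero (T : X →L[ℝ] Y) :
    WithLp p (X × ℝ) →L[ℝ] WithLp q (Y × ℝ) :=
  ((WithLp.prodContinuousLinearEquiv q ℝ Y ℝ).symm : Y × ℝ →L[ℝ] WithLp q (Y × ℝ)) ∘L
    ContinuousLinearMap.inl ℝ Y ℝ ∘L T ∘L WithLp.fstL p ℝ X ℝ

variable (X Y) in
/-- The operator `(x, a) ↦ (0, a)` from `X ⊕_p ℝ` to `Y ⊕_q ℝ`. -/
noncomputable def scalarPart : WithLp p (X × ℝ) →L[ℝ] WithLp q (Y × ℝ) :=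
  ((WithLp.prodContinuousLinearEquiv q ℝ Y ℝ).symm : Y × ℝ →L[ℝ] WithLp q (Y × ℝ)) ∘L
    ContinuousLinearMap.inr ℝ Y ℝ ∘L WithLp.sndL p ℝ X ℝ

variable {p q}

@[simp]
theorem extendByZero_apply (T : X →L[ℝ] Y) (z : WithLp p (X × ℝ)) :
    extendByZero p q T z = WithLp.toLp q (T z.fst, 0) := rfl

@[simp]
theorem scalarPart_apply (z : WithLp p (X × ℝ)) :
    scalarPart X Y p q z = WithLp.toLp q (0, z.snd) := rfl

theorem rank_range_scalarPart_le_one :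
    Module.rank ℝ (LinearMap.range (scalarPart X Y p q).toLinearMap) ≤ 1 := by
  rw [rank_submodule_le_one_iff']
  refine ⟨WithLp.toLp q (0, 1), ?_⟩
  rintro _ ⟨z, rfl⟩
  refine Submodule.mem_span_singleton.2 ⟨z.snd, ?_⟩
  simp [← WithLp.toLp_smul]

theorem isCompactOperator_scalarPart : IsCompactOperator (scalarPart X Y p q) := by
  exact ((isCompactOperator_id (E := ℝ)).clm_comp
    (((WithLp.prodContinuousLinearEquiv q ℝ Y ℝ).symm : Y × ℝ →L[ℝ] WithLp q (Y × ℝ)) ∘L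
      ContinuousLinearMap.inr ℝ Y ℝ)).comp_clm (WithLp.sndL p ℝ X ℝ)

variable [Fact (1 ≤ q)]

theorem norm_extendByZero_add_scalarPart_apply_rpow (hq : q ≠ ∞) (T : X →L[ℝ] Y)
    (z : WithLp p (X × ℝ)) :
    ‖(extendByZero p q T + scalarPart X Y p q) z‖ ^ q.toReal =
      ‖T z.fst‖ ^ q.toReal + |z.snd| ^ q.toReal := by
  have hr : 0 < q.toReal := ENNReal.toReal_pos (one_pos.trans_le Fact.out).ne' hq
  rw [WithLp.prod_norm_rpow_eq_add hr]
  simp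

variable [Fact (1 ≤ p)]

theorem norm_extendByZero_le (T : X →L[ℝ] Y) : ‖extendByZero p q T‖ ≤ ‖T‖ := by
  refine ContinuousLinearMap.opNorm_le_bound _ (norm_nonneg T) fun z => ?_
  rw [extendByZero_apply, WithLp.norm_toLp_fst]
  exact T.le_opNorm_of_le (WithLp.norm_fst_le _ z)

theorem rpow_add_rpow_le_norm_rpow (hq : q ≠ ∞) (T : X →L[ℝ] Y) {u a : ℝ} (hu : 0 ≤ u)
    (hua : ‖WithLp.toLp p (u, a)‖ ≤ 1) :
    (‖T‖ * u) ^ q.toReal + |a| ^ q.toReal ≤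
      ‖extendByZero p q T + scalarPart X Y p q‖ ^ q.toReal := by
  have hp : p ≠ 0 := (one_pos.trans_le (Fact.out : 1 ≤ p)).ne'
  have hr : 0 < q.toReal := ENNReal.toReal_pos (one_pos.trans_le Fact.out).ne' hq
  have hcont : Continuous fun t : ℝ => (t * u) ^ q.toReal + |a| ^ q.toReal :=
    ((continuous_id.mul continuous_const).rpow_const fun _ => Or.inr hr.le).add continuous_const
  rcases (norm_nonneg T).eq_or_lt with h0 | h0
  · have h := (extendByZero p q T + scalarPart X Y p q).unit_le_opNorm
      (WithLp.toLp p (0, a)) ((WithLp.prod_norm_le_prod_norm hp (z := WithLp.toLp p (0, a))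
        (w := WithLp.toLp p (u, a)) (by simp) le_rfl).trans hua)
    have h' := Real.rpow_le_rpow (norm_nonneg _) h hr.le
    rw [norm_extendByZero_add_scalarPart_apply_rpow hq] at h'
    simpa [← h0] using h'
  · refine le_of_tendsto (hcont.continuousAt.tendsto.mono_left nhdsWithin_le_nhds :
      Tendsto _ (𝓝[<] ‖T‖) _) ?_
    filter_upwards [Ioo_mem_nhdsLT h0] with t ht
    obtain ⟨x, hx, htx⟩ := T.exists_lt_apply_of_lt_opNorm ht.2
    have hmem : ‖WithLp.toLp p (u • x, a)‖ ≤ 1 := by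
      refine (WithLp.prod_norm_le_prod_norm hp (z := WithLp.toLp p (u • x, a))
        (w := WithLp.toLp p (u, a)) ?_ le_rfl).trans hua
      simpa [norm_smul] using mul_le_of_le_one_right (abs_nonneg u) hx.le
    have h := Real.rpow_le_rpow (norm_nonneg _)
      ((extendByZero p q T + scalarPart X Y p q).unit_le_opNorm _ hmem) hr.le
    rw [norm_extendByZero_add_scalarPart_apply_rpow hq] at h
    refine le_trans ?_ h
    simp only [WithLp.toLp_fst, WithLp.toLp_snd, map_smul, norm_smul, Real.norm_eq_abs,
      abs_of_nonneg hu]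
    have := ht.1
    rw [mul_comm u]
    gcongr

theorem one_lt_norm_extendByZero_add_scalarPart (hqp : q < p) {T : X →L[ℝ] Y} (hT : 0 < ‖T‖) :
    1 < ‖extendByZero p q T + scalarPart X Y p q‖ := by
  have hq0 : q ≠ 0 := (one_pos.trans_le (Fact.out : 1 ≤ q)).ne'
  have hr : 0 < q.toReal := ENNReal.toReal_pos hq0 hqp.ne_top
  obtain ⟨u, a, hu, ha, hua, h⟩ := WithLp.exists_norm_le_one_lt_mul_rpow_add_mul_rpow hq0 hqp
    (Real.rpow_pos_of_pos hT q.toReal) one_pos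
  have h' := rpow_add_rpow_le_norm_rpow hqp.ne_top T hu.le hua
  rw [Real.mul_rpow hT.le hu.le, abs_of_pos ha] at h'
  refine (Real.rpow_lt_rpow_iff zero_le_one (norm_nonneg _) hr).1 ?_
  rw [Real.one_rpow]
  linarith

theorem norm_lt_norm_extendByZero_add_scalarPart (hqp : q < p) {T : X →L[ℝ] Y} (hT : 0 < ‖T‖) :
    ‖T‖ < ‖extendByZero p q T + scalarPart X Y p q‖ := by
  have hp0 : p ≠ 0 := (one_pos.trans_le (Fact.out : 1 ≤ p)).ne'
  have hq0 : q ≠ 0 := (one_pos.trans_le (Fact.out : 1 ≤ q)).ne'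
  have hr : 0 < q.toReal := ENNReal.toReal_pos hq0 hqp.ne_top
  obtain ⟨u, a, hu, ha, hua, h⟩ := WithLp.exists_norm_le_one_lt_mul_rpow_add_mul_rpow hq0 hqp
    one_pos (Real.rpow_pos_of_pos hT q.toReal)
  rw [← WithLp.prod_norm_swap hp0] at hua
  have h' := rpow_add_rpow_le_norm_rpow hqp.ne_top T ha.le hua
  rw [Real.mul_rpow hT.le ha.le, abs_of_pos hu] at h'
  refine (Real.rpow_lt_rpow_iff hT.le (norm_nonneg _) hr).1 ?_
  linarith

theorem not_normAttains_extendByZero_add_scalarPart (hqp : q < p) {T : X →L[ℝ] Y}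
    (hT : ¬ NormAttains T) : ¬ NormAttains (extendByZero p q T + scalarPart X Y p q) := by
  rintro ⟨z, hz, hzS⟩
  have hp0 : p ≠ 0 := (one_pos.trans_le (Fact.out : 1 ≤ p)).ne'
  have hr : 0 < q.toReal :=
    ENNReal.toReal_pos (one_pos.trans_le (Fact.out : 1 ≤ q)).ne' hqp.ne_top
  have hone := one_lt_norm_extendByZero_add_scalarPart hqp (norm_pos_of_not_normAttains hT)
  have hval := norm_extendByZero_add_scalarPart_apply_rpow hqp.ne_top T z
  rw [hzS] at hval
  rcases eq_or_ne z.fst 0 with h0 | h0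
  · rw [h0, map_zero, norm_zero, Real.zero_rpow hr.ne', zero_add] at hval
    have h1 := Real.one_lt_rpow hone hr
    rw [hval] at h1
    exact h1.not_ge (Real.rpow_le_one (abs_nonneg _) ((WithLp.norm_snd_le _ z).trans hz) hr.le)
  · have hlt := Real.rpow_lt_rpow (norm_nonneg _) (norm_apply_lt_of_not_normAttains hT h0) hr
    have hle := rpow_add_rpow_le_norm_rpow hqp.ne_top T (norm_nonneg z.fst)
      ((WithLp.prod_norm_le_prod_norm hp0 (w := z) (z := WithLp.toLp p (‖z.fst‖, z.snd))
        (by simp) le_rfl).trans hz)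
    linarith

end Extension

theorem pair_with_sums_fails_CPP
    (X Y : Type*) [NormedAddCommGroup X] [NormedSpace ℝ X] [CompleteSpace X]
    [NormedAddCommGroup Y] [NormedSpace ℝ Y] [CompleteSpace Y]
    (T : X →L[ℝ] Y) (hT : ¬ NormAttains T)
    (p q : ℝ≥0∞) [Fact (1 ≤ p)] [Fact (1 ≤ q)] (hqp : q < p) (hq : q ≠ ∞) :
    (∃ T' R' : WithLp p (X × ℝ) →L[ℝ] WithLp q (Y × ℝ),
      (∀ z : WithLp p (X × ℝ),
        WithLp.equiv q (Y × ℝ) (T' z) = (T ((WithLp.equiv p (X × ℝ)) z).1, 0)) ∧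
      (∀ z : WithLp p (X × ℝ),
        WithLp.equiv q (Y × ℝ) (R' z) = (0, ((WithLp.equiv p (X × ℝ)) z).2)) ∧
      Module.rank ℝ (LinearMap.range (R' : WithLp p (X × ℝ) →ₗ[ℝ] WithLp q (Y × ℝ))) ≤ 1 ∧
      ‖T'‖ < ‖T' + R'‖ ∧ ¬ NormAttains (T' + R')) ∧
    ¬ CPP (WithLp p (X × ℝ)) (WithLp q (Y × ℝ)) := by
  have hlt : ‖extendByZero p q T‖ < ‖extendByZero p q T + scalarPart X Y p q‖ :=
    (norm_extendByZero_le T).trans_lt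
      (norm_lt_norm_extendByZero_add_scalarPart hqp (norm_pos_of_not_normAttains hT))
  have hnot := not_normAttains_extendByZero_add_scalarPart hqp hT
  exact ⟨⟨extendByZero p q T, scalarPart X Y p q, fun _ => rfl, fun _ => rfl,
    rank_range_scalarPart_le_one, hlt, hnot⟩,
    fun h => hnot (h _ _ isCompactOperator_scalarPart hlt)⟩
end

section
/- Let X and Y be real Banach spaces, let X₁ be a closed linear subspace of X, and let Y₁ be a closed linear subspace of Y. If the pair (X, Y) has the compact perturbation property, then the pair (X/X₁, Y₁) has the compact perturbation property, where X/X₁ carries the quotient norm and Y₁ carries the norm induced from Y. -/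
open Filter Topology

/-- Precomposition with a quotient map preserves the operator norm. -/
theorem opNorm_comp_mkQL {X Y : Type*} [NormedAddCommGroup X] [NormedSpace ℝ X]
    [NormedAddCommGroup Y] [NormedSpace ℝ Y] (X₁ : Submodule ℝ X) [IsClosed (X₁ : Set X)]
    (S : X ⧸ X₁ →L[ℝ] Y) : ‖S.comp X₁.mkQL‖ = ‖S‖ := by
  apply le_antisymm
  · refine ContinuousLinearMap.opNorm_le_bound _ (norm_nonneg S) fun x => ?_
    exact (S.le_opNorm _).trans
      (mul_le_mul_of_nonneg_left (Submodule.Quotient.norm_mk_le X₁ x) (norm_nonneg _))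
  · refine ContinuousLinearMap.opNorm_le_bound _ (norm_nonneg _) fun z => ?_
    have hlim : Tendsto (fun ε : ℝ => ‖S.comp X₁.mkQL‖ * (‖z‖ + ε)) (𝓝[>] 0)
        (𝓝 (‖S.comp X₁.mkQL‖ * (‖z‖ + 0))) :=
      (Continuous.tendsto (by fun_prop) 0).mono_left nhdsWithin_le_nhds
    rw [add_zero] at hlim
    refine ge_of_tendsto hlim ?_
    filter_upwards [self_mem_nhdsWithin] with ε hε
    obtain ⟨x, rfl, hx⟩ := Submodule.Quotient.norm_mk_lt z hε
    exact ((S.comp X₁.mkQL).le_opNorm x).trans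
      (mul_le_mul_of_nonneg_left hx.le (norm_nonneg _))

theorem CPP_quotient_subspace
    (X Y : Type*) [NormedAddCommGroup X] [NormedSpace ℝ X] [CompleteSpace X]
    [NormedAddCommGroup Y] [NormedSpace ℝ Y] [CompleteSpace Y]
    (X₁ : Submodule ℝ X) [IsClosed (X₁ : Set X)]
    (Y₁ : Submodule ℝ Y) (hY₁ : IsClosed (Y₁ : Set Y))
    (h : CPP X Y) :
    CPP (X ⧸ X₁) Y₁ := by
  intro T K hK hTK
  let lift (S : X ⧸ X₁ →L[ℝ] Y₁) : X →L[ℝ] Y := Y₁.subtypeL.comp (S.comp X₁.mkQL)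
  have norm_lift (S : X ⧸ X₁ →L[ℝ] Y₁) : ‖lift S‖ = ‖S‖ :=
    (Y₁.subtypeₗᵢ.norm_toContinuousLinearMap_comp).trans (opNorm_comp_mkQL X₁ S)
  have lift_add : lift T + lift K = lift (T + K) := rfl
  have compact_lift : IsCompactOperator (lift K) :=
    (hK.comp_clm X₁.mkQL).clm_comp Y₁.subtypeL
  obtain ⟨x, hx, hattain⟩ := h (lift T) (lift K) compact_lift (by
    rwa [lift_add, norm_lift, norm_lift])
  rw [lift_add, norm_lift] at hattain
  exact ⟨X₁.mkQL x, (Submodule.Quotient.norm_mk_le X₁ x).trans hx, hattain⟩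
end
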